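/- For every h ∈ ℝ, the function μ ↦ log 2 + Φ_μ(0,h) − (1/2)∫_0^1 s ξ''(s) μ([0,s]) ds attains its minimum over 𝓜 at exactly one measure; i.e., there exists a unique Parisi measure. -/

import Mathlib

open MeasureTheory ProbabilityTheory Real Set Filter

noncomputable section

/-- `ξ(s) = ∑_{p≥2} β_p² s^p` (we use `β : ℕ → ℝ` with `β 0 = β 1 = 0`). -/
def xiFn (β : ℕ → ℝ) (s : ℝ) : ℝ := ∑' p : ℕ, β p ^ 2 * s ^ p

/-- `ξ'(s)`. -/
def xiD (β : ℕ → ℝ) (s : ℝ) : ℝ := ∑' p : ℕ, (p : ℝ) * β p ^ 2 * s ^ (p - 1)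

/-- `ζ(s) = ξ''(s)`. -/
def zetaFn (β : ℕ → ℝ) (s : ℝ) : ℝ :=
  ∑' p : ℕ, (p : ℝ) * ((p : ℝ) - 1) * β p ^ 2 * s ^ (p - 2)

/-- admissible sequence of temperature parameters -/
def ValidBeta (β : ℕ → ℝ) : Prop :=
  β 0 = 0 ∧ β 1 = 0 ∧ (∀ p, 0 ≤ β p) ∧ (∃ p, 2 ≤ p ∧ 0 < β p) ∧
    Summable fun p : ℕ => (2 : ℝ) ^ p * β p ^ 2

/-- membership in `𝓜`: a Borel probability measure concentrated on `[0,1]` -/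
def MemM (μ : Measure ℝ) : Prop := IsProbabilityMeasure μ ∧ μ (Icc (0 : ℝ) 1)ᶜ = 0

/-- member of `𝓜_d`: finitely supported -/
def FinSupp (μ : Measure ℝ) : Prop := ∃ S : Finset ℝ, μ ((S : Set ℝ))ᶜ = 0

/-- the distribution function `α(s) = μ([0,s])` -/
def distF (μ : Measure ℝ) (s : ℝ) : ℝ := (μ (Icc 0 s)).toReal

/-- the metric `d(μ,ν) = ∫_0^1 |μ([0,s]) - ν([0,s])| ds` -/
def dM (μ ν : Measure ℝ) : ℝ := ∫ s in (0 : ℝ)..1, |distF μ s - distF ν s|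

/-- the smallest atom of `μ` strictly after `s` (or `1` if there is none) -/
def nextPt (μ : Measure ℝ) (s : ℝ) : ℝ :=
  sInf ({q : ℝ | s < q ∧ q ≤ 1 ∧ μ {q} ≠ 0} ∪ {1})

/-- one step of the backward recursion defining the Parisi PDE solution:
`(1/m) log E exp (m Φ(t, x + z √(ξ'(t) - ξ'(s))))`, interpreted as
`E Φ(t, x + z √(ξ'(t) - ξ'(s)))` when `m = 0`. -/
def gStep (β : ℕ → ℝ) (Φ : ℝ → ℝ → ℝ) (m t s x : ℝ) : ℝ :=
  if m = 0 then ∫ z, Φ t (x + z * Real.sqrt (xiD β t - xiD β s)) ∂(gaussianReal 0 1)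
  else m⁻¹ * Real.log
    (∫ z, Real.exp (m * Φ t (x + z * Real.sqrt (xiD β t - xiD β s))) ∂(gaussianReal 0 1))

/-- `Φ` is the Parisi PDE solution of a finitely supported `μ`. -/
def IsAtomicSol (β : ℕ → ℝ) (μ : Measure ℝ) (Φ : ℝ → ℝ → ℝ) : Prop :=
  (∀ x : ℝ, Φ 1 x = Real.log (Real.cosh x)) ∧
  (∀ s ∈ Ico (0 : ℝ) 1, ∀ x : ℝ, Φ s x = gStep β Φ (distF μ s) (nextPt μ s) s x)

/-- `Φ` is the Parisi family `μ ↦ Φ_μ`: it satisfies the backward recursion on `𝓜_d`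
and is `d`-continuous on `𝓜` (uniformly in `(s,x) ∈ [0,1] × ℝ`). -/
def IsParisiFamily (β : ℕ → ℝ) (Φ : Measure ℝ → ℝ → ℝ → ℝ) : Prop :=
  (∀ μ, MemM μ → FinSupp μ → IsAtomicSol β μ (Φ μ)) ∧
  (∀ μ, MemM μ → ∀ ε : ℝ, 0 < ε → ∃ δ : ℝ, 0 < δ ∧ ∀ ν, MemM ν → dM μ ν < δ →
      ∀ s ∈ Icc (0 : ℝ) 1, ∀ x : ℝ, |Φ μ s x - Φ ν s x| < ε)

/-- `B` is a standard Brownian motion under `P`. -/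
def IsStdBM {Ω : Type*} [MeasurableSpace Ω] (P : Measure Ω) (B : ℝ → Ω → ℝ) : Prop :=
  (∀ t : ℝ, Measurable (B t)) ∧
  (∀ᵐ ω ∂P, B 0 ω = 0) ∧
  (∀ᵐ ω ∂P, Continuous fun t => B t ω) ∧
  (∀ s t : ℝ, 0 ≤ s → s ≤ t →
    Measure.map (fun ω => B t ω - B s ω) P = gaussianReal 0 (Real.toNNReal (t - s))) ∧
  (∀ s t : ℝ, 0 ≤ s → s ≤ t →
    Indep (MeasurableSpace.comap (fun ω => B t ω - B s ω) inferInstance)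
      (⨆ v ∈ Icc (0 : ℝ) s, MeasurableSpace.comap (B v) inferInstance) P)

/-- the space `𝓓[s,t]`: progressively measurable processes bounded by `1` on `[s,t]` -/
def InD {Ω : Type*} {mΩ : MeasurableSpace Ω} (𝓕 : Filtration ℝ mΩ) (s t : ℝ)
    (u : ℝ → Ω → ℝ) : Prop :=
  ProgMeasurable 𝓕 u ∧ ∀ r ∈ Icc s t, ∀ ω, |u r ω| ≤ 1

/-- the norm `‖u‖ = (E ∫_s^t u(r)² dr)^{1/2}` on `𝓓[s,t]` -/
def normD {Ω : Type*} [MeasurableSpace Ω] (P : Measure Ω) (s t : ℝ)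
    (u : ℝ → Ω → ℝ) : ℝ :=
  Real.sqrt (∫ ω, (∫ r in s..t, (u r ω) ^ 2) ∂P)

/-- the functional
`F^{s,t}(u,x) = E[Φ_μ(t, x + ∫_s^t α ζ u dr + W(t) - W(s)) - (1/2)∫_s^t α ζ u² dr]`,
where `W r = B (ξ' r)`. -/
def Ffn {Ω : Type*} [MeasurableSpace Ω] (P : Measure Ω) (β : ℕ → ℝ) (μ : Measure ℝ)
    (Φ : ℝ → ℝ → ℝ) (W : ℝ → Ω → ℝ) (s t : ℝ) (u : ℝ → Ω → ℝ) (x : ℝ) : ℝ :=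
  ∫ ω, (Φ t (x + (∫ r in s..t, distF μ r * zetaFn β r * u r ω) + (W t ω - W s ω))
      - (1 / 2) * ∫ r in s..t, distF μ r * zetaFn β r * (u r ω) ^ 2) ∂P


/-- the value of the Parisi formula functional at `μ`:
`log 2 + Φ_μ(0,h) - (1/2) ∫_0^1 s ξ''(s) μ([0,s]) ds` -/
def parisiVal (β : ℕ → ℝ) (Φ : Measure ℝ → ℝ → ℝ → ℝ) (h : ℝ) (μ : Measure ℝ) : ℝ :=
  Real.log 2 + Φ μ 0 h - (1 / 2) * ∫ s in (0 : ℝ)..1, s * zetaFn β s * distF μ s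

/-! ### Gaussian tools -/

abbrev gam : Measure ℝ := gaussianReal 0 1

lemma integrable_exp_abs (c : ℝ) : Integrable (fun z : ℝ => Real.exp (c * |z|)) gam := by
  have h1 := integrable_exp_mul_gaussianReal (μ := 0) (v := 1) c
  have h2 := integrable_exp_mul_gaussianReal (μ := 0) (v := 1) (-c)
  refine (h1.add h2).mono' (by fun_prop) (Eventually.of_forall fun z => ?_)
  rw [Real.norm_eq_abs, abs_of_pos (Real.exp_pos _)]
  simp only [Pi.add_apply]
  rcases abs_cases z with ⟨h, _⟩ | ⟨h, _⟩ <;> rw [h]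
  · have := Real.exp_pos (-c * z); linarith
  · have := Real.exp_pos (c * z)
    have e : c * -z = -c * z := by ring
    rw [e]; linarith

/-- measurable functions dominated by `C e^{c|z|}` are integrable -/
lemma int_dom {g : ℝ → ℝ} (hg : Measurable g) (C c : ℝ)
    (h : ∀ z, |g z| ≤ C * Real.exp (c * |z|)) : Integrable g gam :=
  ((integrable_exp_abs c).const_mul C).mono' hg.aestronglyMeasurable
    (Eventually.of_forall fun z => by simpa using h z)

def KK (c : ℝ) : ℝ := ∫ z, Real.exp (c * |z|) ∂gam

lemma KK_ge_one {c : ℝ} (hc : 0 ≤ c) : 1 ≤ KK c := by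
  have : ∫ _z : ℝ, (1 : ℝ) ∂gam ≤ KK c := by
    apply integral_mono (integrable_const _) (integrable_exp_abs c)
    intro z
    exact Real.one_le_exp (by positivity)
  simpa using this

lemma integral_le_KK {g : ℝ → ℝ} (hg : Measurable g) {C c : ℝ}
    (h : ∀ z, |g z| ≤ C * Real.exp (c * |z|)) : |∫ z, g z ∂gam| ≤ C * KK c := by
  have h1 : |∫ z, g z ∂gam| ≤ ∫ z, |g z| ∂gam := abs_integral_le_integral_abs
  refine h1.trans ?_
  rw [KK, ← integral_const_mul]
  exact integral_mono (int_dom hg C c h).abs ((integrable_exp_abs c).const_mul C) h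

lemma gam_shift (g : ℝ → ℝ) (b : ℝ) :
    ∫ z, g z ∂gam = ∫ z, g (z + b) * Real.exp (-b * z - b ^ 2 / 2) ∂gam := by
  rw [integral_gaussianReal_eq_integral_smul one_ne_zero,
    integral_gaussianReal_eq_integral_smul one_ne_zero]
  rw [← integral_add_right_eq_self _ b]
  congr 1
  ext z
  simp only [gaussianPDFReal, smul_eq_mul, NNReal.coe_one, sub_zero, mul_one]
  have : Real.exp (-(z + b) ^ 2 / 2) = Real.exp (-z ^ 2 / 2) * Real.exp (-b * z - b ^ 2 / 2) := by
    rw [← Real.exp_add]; congr 1; ring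
  rw [this]; ring

lemma gam_id : ∫ z, z ∂gam = 0 := integral_id_gaussianReal

lemma integrable_id_gam : Integrable (fun z : ℝ => z) gam :=
  int_dom measurable_id 1 1 fun z => by
    have := Real.add_one_le_exp |z|
    simp; linarith

lemma sq_le_exp (z : ℝ) : z ^ 2 ≤ 2 * Real.exp |z| := by
  have := Real.quadratic_le_exp_of_nonneg (abs_nonneg z)
  have h2 : |z| ^ 2 = z ^ 2 := sq_abs z
  have := abs_nonneg z
  nlinarith

lemma abs_le_exp (z : ℝ) : |z| ≤ Real.exp |z| := by
  have := Real.add_one_le_exp |z|; linarith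

lemma integrable_sq_gam : Integrable (fun z : ℝ => z ^ 2) gam :=
  int_dom (by fun_prop) 2 1 fun z => by
    rw [abs_of_nonneg (sq_nonneg z), one_mul]; exact sq_le_exp z

lemma gam_sq : ∫ z, z ^ 2 ∂gam = 1 := by
  have h := variance_fun_id_gaussianReal (μ := 0) (v := 1)
  rw [variance_eq_integral (by fun_prop)] at h
  simpa using h

/-- differentiation of Gaussian averages -/
lemma gam_hasDerivAt {φ φ' : ℝ → ℝ} (hd : ∀ x, HasDerivAt φ (φ' x) x) {C c r : ℝ} (hc : 0 ≤ c)
    (h0 : ∀ x, |φ x| ≤ C * Real.exp (c * |x|)) (h1 : ∀ x, |φ' x| ≤ C * Real.exp (c * |x|))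
    (x : ℝ) :
    HasDerivAt (fun x => ∫ z, φ (x + z * r) ∂gam) (∫ z, φ' (x + z * r) ∂gam) x := by
  have hm : Measurable φ := (continuous_iff_continuousAt.2 fun x => (hd x).continuousAt).measurable
  have hm' : Measurable φ' := by
    have : φ' = deriv φ := by ext x; exact (hd x).deriv.symm
    rw [this]; exact measurable_deriv φ
  have hC : 0 ≤ C := by
    have := (abs_nonneg _).trans (h0 0); simpa using this
  have key : ∀ y ∈ Metric.ball x 1, ∀ z : ℝ, C * Real.exp (c * |y + z * r|) ≤
      (C * Real.exp (c * (|x| + 1))) * Real.exp ((c * |r|) * |z|) := by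
    intro y hy z
    rw [mul_assoc, ← Real.exp_add]
    apply mul_le_mul_of_nonneg_left _ hC
    apply Real.exp_le_exp.2
    have h2 : |y + z * r| ≤ |y| + |z| * |r| := (abs_add_le _ _).trans (by rw [abs_mul])
    have h3 : |y| ≤ |x| + 1 := by
      have := Metric.mem_ball.1 hy
      rw [Real.dist_eq] at this
      have h4 := abs_sub_abs_le_abs_sub y x
      linarith
    nlinarith [abs_nonneg z, abs_nonneg r]
  refine (hasDerivAt_integral_of_dominated_loc_of_deriv_le
    (F := fun x z => φ (x + z * r)) (F' := fun x z => φ' (x + z * r))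
    (bound := fun z => (C * Real.exp (c * (|x| + 1))) * Real.exp ((c * |r|) * |z|))
    (Metric.ball_mem_nhds x one_pos) ?_ ?_ ?_ ?_ ?_ ?_).2
  · exact Eventually.of_forall fun y => (hm.comp (by fun_prop)).aestronglyMeasurable
  · refine int_dom (hm.comp (by fun_prop)) _ (c * |r|) fun z => (h0 _).trans
      (key x (Metric.mem_ball_self one_pos) z)
  · exact (hm'.comp (by fun_prop)).aestronglyMeasurable
  · exact Eventually.of_forall fun z y hy => (h1 _).trans (key y hy z)
  · exact (integrable_exp_abs _).const_mul _
  · refine Eventually.of_forall fun z y hy => ?_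
    have := (hd (y + z * r)).comp y ((hasDerivAt_id y).add_const (z * r))
    simpa [Function.comp_def] using this

lemma jensen_exp {X : ℝ → ℝ} (hX : Integrable X gam) (hE : Integrable (fun z => Real.exp (X z)) gam) :
    Real.exp (∫ z, X z ∂gam) ≤ ∫ z, Real.exp (X z) ∂gam :=
  convexOn_exp.map_integral_le Real.continuous_exp.continuousOn isClosed_univ
    (Eventually.of_forall fun _ => mem_univ _) hX hE

/-! ### The class of functions preserved by the recursion -/

structure Cls (f f1 f2 : ℝ → ℝ) (e : ℝ) : Prop where
  d1 : ∀ x, HasDerivAt f (f1 x) x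
  d2 : ∀ x, HasDerivAt f1 (f2 x) x
  b1 : ∀ x, |f1 x| ≤ 1
  b2 : ∀ x, f2 x + f1 x ^ 2 ≤ 1
  lo : ∀ x, Real.exp (-(2 * e * (3 + x ^ 2))) ≤ f2 x

namespace Cls
variable {f f1 f2 : ℝ → ℝ} {e : ℝ}

lemma cont (h : Cls f f1 f2 e) : Continuous f :=
  continuous_iff_continuousAt.2 fun x => (h.d1 x).continuousAt

lemma cont1 (h : Cls f f1 f2 e) : Continuous f1 :=
  continuous_iff_continuousAt.2 fun x => (h.d2 x).continuousAt

lemma meas2 (h : Cls f f1 f2 e) : Measurable f2 := by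
  have : f2 = deriv f1 := by ext x; exact (h.d2 x).deriv.symm
  rw [this]; exact measurable_deriv f1

lemma f2_nonneg (h : Cls f f1 f2 e) (x : ℝ) : 0 ≤ f2 x := (Real.exp_pos _).le.trans (h.lo x)

lemma f2_le (h : Cls f f1 f2 e) (x : ℝ) : f2 x ≤ 1 := by
  have := h.b2 x; nlinarith [sq_nonneg (f1 x)]

lemma abs_f2 (h : Cls f f1 f2 e) (x : ℝ) : |f2 x| ≤ 1 :=
  abs_le.2 ⟨by linarith [h.f2_nonneg x], h.f2_le x⟩

lemma lip (h : Cls f f1 f2 e) (x y : ℝ) : |f x - f y| ≤ |x - y| := by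
  have := Convex.norm_image_sub_le_of_norm_hasDerivWithin_le (f := f) (f' := f1) (C := 1)
    (s := Set.univ) (x := y) (y := x) (fun x _ => (h.d1 x).hasDerivWithinAt)
    (fun x _ => by simpa using h.b1 x) convex_univ (mem_univ _) (mem_univ _)
  simpa using this

lemma lip1 (h : Cls f f1 f2 e) (x y : ℝ) : |f1 x - f1 y| ≤ |x - y| := by
  have := Convex.norm_image_sub_le_of_norm_hasDerivWithin_le (f := f1) (f' := f2) (C := 1)
    (s := Set.univ) (x := y) (y := x) (fun x _ => (h.d2 x).hasDerivWithinAt)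
    (fun x _ => by simpa using h.abs_f2 x) convex_univ (mem_univ _) (mem_univ _)
  simpa using this

lemma growth (h : Cls f f1 f2 e) (x : ℝ) : |f x| ≤ |f 0| + |x| := by
  have h1 := h.lip x 0
  have h2 := abs_sub_abs_le_abs_sub (f x) (f 0)
  rw [sub_zero] at h1
  linarith

lemma taylor (h : Cls f f1 f2 e) (x a b : ℝ) :
    |f b - f a - f1 x * (b - a)| ≤ (|a - x| + |b - a|) * |b - a| := by
  have := Convex.norm_image_sub_le_of_norm_hasDerivWithin_le (f := fun t => f t - f1 x * t)
    (f' := fun t => f1 t - f1 x) (C := |a - x| + |b - a|)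
    (s := Set.uIcc a b) (x := a) (y := b)
    (fun t _ => by
      have := (h.d1 t).sub ((hasDerivAt_id t).const_mul (f1 x))
      simp only [mul_one] at this
      exact this.hasDerivWithinAt)
    (fun t ht => by
      rw [Real.norm_eq_abs]
      have h1 := h.lip1 t x
      have h2 : |t - a| ≤ |b - a| := abs_sub_left_of_mem_uIcc ht
      have h3 : |t - x| ≤ |a - x| + |t - a| := by
        have := abs_add_le (a - x) (t - a)
        rwa [show a - x + (t - a) = t - x by ring] at this
      linarith) (convex_uIcc a b) left_mem_uIcc right_mem_uIcc
  rw [Real.norm_eq_abs, Real.norm_eq_abs] at this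
  convert this using 2
  ring

end Cls

/-- one step of the recursion, with `r` the standard deviation -/
def Pst (m r : ℝ) (f : ℝ → ℝ) (x : ℝ) : ℝ :=
  m⁻¹ * Real.log (∫ z, Real.exp (m * f (x + z * r)) ∂gam)

def Yf (f1 : ℝ → ℝ) (m r x z : ℝ) : ℝ := x + (z + m * r * f1 x) * r

def Sf (f f1 : ℝ → ℝ) (m r x z : ℝ) : ℝ :=
  f (Yf f1 m r x z) - Pst m r f x - r * f1 x * z - m * r ^ 2 * f1 x ^ 2 / 2

section step
variable {f f1 f2 : ℝ → ℝ} {e m r : ℝ}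

lemma exp_dom (h : Cls f f1 f2 e) (hm : 0 ≤ m) (hm1 : m ≤ 1) (x : ℝ) :
    |Real.exp (m * f x)| ≤ Real.exp |f 0| * Real.exp (1 * |x|) := by
  rw [abs_of_pos (Real.exp_pos _), ← Real.exp_add]
  apply Real.exp_le_exp.2
  have h1 := h.growth x
  have h2 := abs_le.1 h1
  have h3 : 0 ≤ |f 0| + |x| := by positivity
  nlinarith

lemma int_exp (h : Cls f f1 f2 e) (hm : 0 ≤ m) (hm1 : m ≤ 1) (x : ℝ) :
    Integrable (fun z => Real.exp (m * f (x + z * r))) gam := by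
  have := h.cont
  refine int_dom (by fun_prop) (Real.exp |f 0| * Real.exp |x|) |r| fun z => ?_
  refine (exp_dom h hm hm1 _).trans ?_
  rw [mul_assoc, ← Real.exp_add |x|]
  apply mul_le_mul_of_nonneg_left _ (Real.exp_pos _).le
  apply Real.exp_le_exp.2
  rw [one_mul]
  exact (abs_add_le _ _).trans (by rw [abs_mul, mul_comm])

lemma Z_pos (h : Cls f f1 f2 e) (hm : 0 ≤ m) (hm1 : m ≤ 1) (x : ℝ) :
    0 < ∫ z, Real.exp (m * f (x + z * r)) ∂gam :=
  integral_exp_pos (int_exp h hm hm1 x)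

lemma exp_Pst (h : Cls f f1 f2 e) (hm : 0 < m) (hm1 : m ≤ 1) (x : ℝ) :
    Real.exp (m * Pst m r f x) = ∫ z, Real.exp (m * f (x + z * r)) ∂gam := by
  rw [Pst, ← mul_assoc, mul_inv_cancel₀ hm.ne', one_mul, Real.exp_log (Z_pos h hm.le hm1 x)]

lemma tilt_shift (h : Cls f f1 f2 e) (hm : 0 < m) (hm1 : m ≤ 1) (x : ℝ) (g : ℝ → ℝ) :
    (∫ z, g (x + z * r) * Real.exp (m * f (x + z * r)) ∂gam) /
      (∫ z, Real.exp (m * f (x + z * r)) ∂gam)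
      = ∫ z, g (Yf f1 m r x z) * Real.exp (m * Sf f f1 m r x z) ∂gam := by
  rw [← exp_Pst h hm hm1, gam_shift _ (m * r * f1 x), ← integral_div]
  congr 1
  ext z
  rw [Sf, show x + (z + m * r * f1 x) * r = Yf f1 m r x z from rfl, mul_assoc, ← Real.exp_add,
    mul_div_assoc, ← Real.exp_sub]
  congr 2
  ring

lemma S_one (h : Cls f f1 f2 e) (hm : 0 < m) (hm1 : m ≤ 1) (x : ℝ) :
    ∫ z, Real.exp (m * Sf f f1 m r x z) ∂gam = 1 := by
  have := tilt_shift h hm hm1 (r := r) x (fun _ => 1)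
  simp only [one_mul] at this
  rw [← this, div_self (Z_pos h hm.le hm1 x).ne']

lemma Yf_cont : Continuous (Yf f1 m r x) := by unfold Yf; fun_prop

lemma Sf_cont (h : Cls f f1 f2 e) (x : ℝ) : Continuous (Sf f f1 m r x) := by
  have := h.cont
  unfold Sf
  have := Yf_cont (f1 := f1) (m := m) (r := r) (x := x)
  fun_prop

lemma Sf_diff (h : Cls f f1 f2 e) (hm : 0 < m) (hm1 : m ≤ 1) (hr : 0 < r) (hr1 : r ≤ 1)
    (x z : ℝ) : |Sf f f1 m r x z - Sf f f1 m r x 0| ≤ r ^ 2 * (3 * Real.exp |z|) ∧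
      |Sf f f1 m r x z - Sf f f1 m r x 0| ≤ 2 * |z| := by
  have e1 : Sf f f1 m r x z - Sf f f1 m r x 0
      = f (Yf f1 m r x z) - f (Yf f1 m r x 0) - f1 x * (Yf f1 m r x z - Yf f1 m r x 0) := by
    simp only [Sf, Yf]; ring
  have e2 : Yf f1 m r x z - Yf f1 m r x 0 = z * r := by simp only [Yf]; ring
  have e3 : Yf f1 m r x 0 - x = m * r ^ 2 * f1 x := by simp only [Yf]; ring
  have h3 : |Yf f1 m r x 0 - x| ≤ r ^ 2 := by
    rw [e3, abs_mul, abs_of_pos (by positivity)]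
    have := h.b1 x
    have h5 := abs_nonneg (f1 x)
    have h6 : m * r ^ 2 ≤ r ^ 2 := by nlinarith [sq_nonneg r]
    nlinarith [sq_nonneg r]
  have hz := abs_nonneg z
  constructor
  · rw [e1]
    refine (h.taylor x _ _).trans ?_
    rw [e2, abs_mul, abs_of_pos hr]
    have h4 := sq_le_exp z
    have h5 := abs_le_exp z
    have h6 : |z| ^ 2 = z ^ 2 := sq_abs z
    have : (|Yf f1 m r x 0 - x| + |z| * r) * (|z| * r) ≤ (r ^ 2 + |z| * r) * (|z| * r) := by
      gcongr
    refine this.trans ?_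
    have h7 : (r ^ 2 + |z| * r) * (|z| * r) = r ^ 2 * (r * |z| + z ^ 2) := by rw [← h6]; ring
    rw [h7]
    gcongr
    nlinarith
  · rw [e1, e2]
    have h1 := h.lip (Yf f1 m r x z) (Yf f1 m r x 0)
    rw [e2] at h1
    have h2 : |f1 x * (z * r)| ≤ |z| := by
      rw [abs_mul, abs_mul, abs_of_pos hr]
      have := h.b1 x
      have h5 := abs_nonneg (f1 x)
      have : |z| * r ≤ |z| := by nlinarith
      have : 0 ≤ |z| * r := by positivity
      nlinarith
    have h3 : |z * r| ≤ |z| := by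
      rw [abs_mul, abs_of_pos hr]; nlinarith
    have := abs_sub (f (Yf f1 m r x z) - f (Yf f1 m r x 0)) (f1 x * (z * r))
    linarith

lemma abs_exp_sub_one (x : ℝ) : |Real.exp x - 1| ≤ |x| * Real.exp |x| := by
  rw [abs_le]
  have h0 := abs_nonneg x
  constructor
  · have := Real.add_one_le_exp x
    have h2 := neg_abs_le x
    have h3 := Real.one_le_exp h0
    nlinarith
  · have h1 : Real.exp x ≤ Real.exp |x| := Real.exp_le_exp.2 (le_abs_self x)
    have h2 := Real.add_one_le_exp (-|x|)
    have h3 := Real.exp_pos |x|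
    have h4 : Real.exp (-|x|) * Real.exp |x| = 1 := by rw [← Real.exp_add]; simp
    nlinarith

lemma exp_quad (x : ℝ) : Real.exp x ≤ 1 + x + x ^ 2 * Real.exp |x| := by
  have h0 := abs_nonneg x
  have h := Real.quadratic_le_exp_of_nonneg h0
  rcases le_or_gt 0 x with hx | hx
  · rw [abs_of_nonneg hx] at *
    have h2 := Real.add_one_le_exp (-x)
    have h3 := Real.exp_pos x
    have h4 : Real.exp (-x) * Real.exp x = 1 := by rw [← Real.exp_add]; simp
    have h5 : (1 - x) * Real.exp x ≤ 1 := by nlinarith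
    rcases le_or_gt x 1 with h6 | h6
    · nlinarith
    · nlinarith
  · have h3 : 1 ≤ Real.exp |x| := Real.one_le_exp h0
    have h5 : Real.exp x ≤ 1 + x + x ^ 2 := by
      have h2 := Real.quadratic_le_exp_of_nonneg (x := -x) (by linarith)
      have h4 : Real.exp (-x) * Real.exp x = 1 := by rw [← Real.exp_add]; simp
      have h6 := Real.exp_pos x
      by_contra hc
      push Not at hc
      have h7 : 0 < 1 + x + x ^ 2 := by nlinarith
      have : (1 + -x + (-x) ^ 2 / 2) * (1 + x + x ^ 2) < 1 := by
        calc _ ≤ Real.exp (-x) * (1 + x + x ^ 2) := by gcongr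
          _ < Real.exp (-x) * Real.exp x := by gcongr
          _ = 1 := h4
      nlinarith [sq_nonneg (x * x), sq_nonneg x, mul_pos_of_neg_of_neg hx hx]
    nlinarith [sq_nonneg x]

def CS : ℝ := 6 * KK 3

lemma CS_ge : 6 ≤ CS := by
  have := KK_ge_one (c := 3) (by norm_num); unfold CS; linarith

lemma Sf_zero (h : Cls f f1 f2 e) (hm : 0 < m) (hm1 : m ≤ 1) (hr : 0 < r) (hr1 : r ≤ 1)
    (x : ℝ) : |Sf f f1 m r x 0| ≤ r ^ 2 * (3 * KK 3) := by
  set S0 := Sf f f1 m r x 0 with hS0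
  have hc : Continuous fun z => Sf f f1 m r x z - S0 := (Sf_cont h x).sub continuous_const
  have hd := fun z => Sf_diff h hm hm1 hr hr1 x z
  have hdom : ∀ z, |Sf f f1 m r x z - S0| ≤ (3 * r ^ 2) * Real.exp (3 * |z|) := fun z => by
    refine (hd z).1.trans ?_
    have : Real.exp |z| ≤ Real.exp (3 * |z|) := Real.exp_le_exp.2 (by linarith [abs_nonneg z])
    nlinarith [sq_nonneg r]
  have hIgr : Integrable (fun z => Sf f f1 m r x z - S0) gam := int_dom hc.measurable _ _ hdom
  have hexp : ∀ z, |Real.exp (m * (Sf f f1 m r x z - S0)) - 1| ≤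
      (m * (r ^ 2 * 3)) * Real.exp (3 * |z|) := fun z => by
    refine (abs_exp_sub_one _).trans ?_
    have h1 : |m * (Sf f f1 m r x z - S0)| = m * |Sf f f1 m r x z - S0| := by
      rw [abs_mul, abs_of_pos hm]
    rw [h1]
    have h2 : m * |Sf f f1 m r x z - S0| ≤ 2 * |z| := by
      have := (hd z).2
      have := abs_nonneg (Sf f f1 m r x z - S0)
      nlinarith
    have h3 : Real.exp (3 * |z|) = Real.exp |z| * Real.exp (2 * |z|) := by
      rw [← Real.exp_add]; congr 1; ring
    rw [h3]
    calc m * |Sf f f1 m r x z - S0| * Real.exp (m * |Sf f f1 m r x z - S0|)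
        ≤ m * (r ^ 2 * (3 * Real.exp |z|)) * Real.exp (2 * |z|) := by
          gcongr; exact (hd z).1
      _ = _ := by ring
  have hmE : Measurable (fun z => Real.exp (m * (Sf f f1 m r x z - S0)) - 1) :=
    (((Real.continuous_exp.comp (hc.const_mul m))).sub continuous_const).measurable
  have hIgrE : Integrable (fun z => Real.exp (m * (Sf f f1 m r x z - S0)) - 1) gam :=
    int_dom hmE _ _ hexp
  -- the value of the exponential integral
  have hval : ∫ z, (Real.exp (m * (Sf f f1 m r x z - S0)) - 1) ∂gam = Real.exp (-(m * S0)) - 1 := by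
    have h1 := S_one h hm hm1 (r := r) x
    have h2 : ∀ z, Real.exp (m * (Sf f f1 m r x z - S0)) - 1
        = Real.exp (-(m * S0)) * Real.exp (m * Sf f f1 m r x z) - 1 := fun z => by
      rw [← Real.exp_add]; congr 2; ring
    have hi : Integrable (fun z => Real.exp (m * Sf f f1 m r x z)) gam := by
      by_contra hni
      rw [integral_undef hni] at h1
      exact zero_ne_one h1
    simp_rw [h2]
    rw [integral_sub (hi.const_mul _) (integrable_const _), integral_const_mul, h1]
    simp
  have hup := integral_le_KK hmE hexp
  rw [hval] at hup
  have hup := (abs_le.1 hup).2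
  have hlow : m * ∫ z, (Sf f f1 m r x z - S0) ∂gam ≤ Real.exp (-(m * S0)) - 1 := by
    rw [← hval, ← integral_const_mul]
    refine integral_mono (hIgr.const_mul m) hIgrE fun z => ?_
    have := Real.add_one_le_exp (m * (Sf f f1 m r x z - S0))
    simp only; linarith
  -- Jensen in exponential form for the lower bound
  have hJ : Real.exp (m * ∫ z, (Sf f f1 m r x z - S0) ∂gam) ≤ Real.exp (-(m * S0)) := by
    have hiE : Integrable (fun z => Real.exp (m * (Sf f f1 m r x z - S0))) gam := by
      have := hIgrE.add (integrable_const 1)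
      refine this.congr (Eventually.of_forall fun z => ?_)
      simp
    have h1 := jensen_exp (hIgr.const_mul m) hiE
    rw [integral_const_mul] at h1
    rw [integral_sub hiE (integrable_const 1)] at hval
    simp only [integral_const, probReal_univ, smul_eq_mul, one_mul] at hval
    linarith
  have hI := abs_le.1 (integral_le_KK hc.measurable hdom)
  have hJ := Real.exp_le_exp.1 hJ
  have hA := Real.add_one_le_exp (-(m * S0))
  rw [abs_le]
  constructor
  · have : m * -S0 ≤ m * (r ^ 2 * (3 * KK 3)) := by linarith
    have := le_of_mul_le_mul_left this hm
    linarith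
  · have : m * S0 ≤ m * (r ^ 2 * (3 * KK 3)) := by
      have := mul_le_mul_of_nonneg_left hI.1 hm.le
      linarith
    exact le_of_mul_le_mul_left this hm

lemma Sf_bound (h : Cls f f1 f2 e) (hm : 0 < m) (hm1 : m ≤ 1) (hr : 0 < r) (hr1 : r ≤ 1)
    (x z : ℝ) : |Sf f f1 m r x z| ≤ r ^ 2 * CS * Real.exp |z| ∧
      |Sf f f1 m r x z| ≤ CS + 2 * |z| := by
  have h0 := Sf_zero h hm hm1 hr hr1 x
  have h1 := Sf_diff h hm hm1 hr hr1 x z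
  have h2 : |Sf f f1 m r x z| ≤ |Sf f f1 m r x z - Sf f f1 m r x 0| + |Sf f f1 m r x 0| := by
    have := abs_add_le (Sf f f1 m r x z - Sf f f1 m r x 0) (Sf f f1 m r x 0)
    rwa [sub_add_cancel] at this
  have hK := KK_ge_one (c := 3) (by norm_num)
  have he := Real.one_le_exp (abs_nonneg z)
  have hr2 : 0 ≤ r ^ 2 := sq_nonneg r
  have hr3 : r ^ 2 ≤ 1 := by nlinarith
  unfold CS
  constructor
  · refine h2.trans ((add_le_add h1.1 h0).trans ?_)
    rw [← mul_add, mul_assoc]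
    apply mul_le_mul_of_nonneg_left _ hr2
    nlinarith
  · nlinarith [h1.2]

def CE : ℝ := CS * Real.exp CS

lemma CE_pos : 0 < CE := by
  have := CS_ge; unfold CE; positivity

lemma expS_bound (h : Cls f f1 f2 e) (hm : 0 < m) (hm1 : m ≤ 1) (hr : 0 < r) (hr1 : r ≤ 1)
    (x z : ℝ) : Real.exp (|m * Sf f f1 m r x z|) ≤ Real.exp CS * Real.exp (2 * |z|) := by
  rw [← Real.exp_add]
  apply Real.exp_le_exp.2
  rw [abs_mul, abs_of_pos hm]
  have := (Sf_bound h hm hm1 hr hr1 x z).2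
  have := abs_nonneg (Sf f f1 m r x z)
  nlinarith

lemma expS_bound' (h : Cls f f1 f2 e) (hm : 0 < m) (hm1 : m ≤ 1) (hr : 0 < r) (hr1 : r ≤ 1)
    (x z : ℝ) : Real.exp (m * Sf f f1 m r x z) ≤ Real.exp CS * Real.exp (2 * |z|) :=
  (Real.exp_le_exp.2 (le_abs_self _)).trans (expS_bound h hm hm1 hr hr1 x z)

lemma expS_sub (h : Cls f f1 f2 e) (hm : 0 < m) (hm1 : m ≤ 1) (hr : 0 < r) (hr1 : r ≤ 1)
    (x z : ℝ) : |Real.exp (m * Sf f f1 m r x z) - 1| ≤ r ^ 2 * CE * Real.exp (3 * |z|) := by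
  refine (abs_exp_sub_one _).trans ?_
  have h1 := expS_bound h hm hm1 hr hr1 x z
  have h2 : |m * Sf f f1 m r x z| ≤ r ^ 2 * CS * Real.exp |z| := by
    rw [abs_mul, abs_of_pos hm]
    have := (Sf_bound h hm hm1 hr hr1 x z).1
    have := abs_nonneg (Sf f f1 m r x z)
    nlinarith
  have h3 : Real.exp (3 * |z|) = Real.exp |z| * Real.exp (2 * |z|) := by
    rw [← Real.exp_add]; congr 1; ring
  rw [h3, CE]
  have hC := CS_ge
  have h4 : 0 ≤ r ^ 2 * CS * Real.exp |z| := by positivity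
  calc _ ≤ (r ^ 2 * CS * Real.exp |z|) * (Real.exp CS * Real.exp (2 * |z|)) := by gcongr
    _ = _ := by ring

end step

section step
variable {f f1 f2 : ℝ → ℝ} {e m r : ℝ}

/-- derivative of the step -/
def U1 (f f1 : ℝ → ℝ) (m r x : ℝ) : ℝ :=
  ∫ z, f1 (Yf f1 m r x z) * Real.exp (m * Sf f f1 m r x z) ∂gam

/-- second derivative of the step -/
def U2 (f f1 f2 : ℝ → ℝ) (m r x : ℝ) : ℝ :=
  ∫ z, f2 (Yf f1 m r x z) * Real.exp (m * Sf f f1 m r x z) ∂gam +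
    m * (∫ z, f1 (Yf f1 m r x z) ^ 2 * Real.exp (m * Sf f f1 m r x z) ∂gam - U1 f f1 m r x ^ 2)

lemma int_w (h : Cls f f1 f2 e) (hm : 0 < m) (hm1 : m ≤ 1) (hr : 0 < r) (hr1 : r ≤ 1)
    (x : ℝ) {g : ℝ → ℝ} (hg : Measurable g) {C c : ℝ} (hb : ∀ z, |g z| ≤ C * Real.exp (c * |z|)) :
    Integrable (fun z => g z * Real.exp (m * Sf f f1 m r x z)) gam := by
  have hc := Sf_cont h (m := m) (r := r) x
  refine int_dom (by have := hc.measurable; fun_prop) (C * Real.exp CS) (c + 2) fun z => ?_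
  rw [abs_mul, abs_of_pos (Real.exp_pos (m * _)), add_mul, Real.exp_add]
  calc _ ≤ (C * Real.exp (c * |z|)) * (Real.exp CS * Real.exp (2 * |z|)) := by
        gcongr
        · exact (abs_nonneg _).trans (hb z)
        · exact hb z
        · exact expS_bound' h hm hm1 hr hr1 x z
    _ = _ := by ring

lemma int_w_one (h : Cls f f1 f2 e) (hm : 0 < m) (hm1 : m ≤ 1) (hr : 0 < r) (hr1 : r ≤ 1)
    (x : ℝ) : Integrable (fun z => Real.exp (m * Sf f f1 m r x z)) gam := by
  have := int_w h hm hm1 hr hr1 x (g := fun _ => 1) measurable_const (C := 1) (c := 0)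
    (fun z => by simp)
  simpa using this

lemma Yf_sub (h : Cls f f1 f2 e) (hm : 0 < m) (hm1 : m ≤ 1) (hr : 0 < r) (hr1 : r ≤ 1)
    (x z : ℝ) : |Yf f1 m r x z - x| ≤ r * Real.exp |z| := by
  have e1 : Yf f1 m r x z - x = r * (z + m * r * f1 x) := by unfold Yf; ring
  rw [e1, abs_mul, abs_of_pos hr]
  gcongr
  have h1 : |m * r * f1 x| ≤ 1 := by
    rw [abs_mul, abs_of_pos (by positivity)]
    have := h.b1 x
    have h5 := abs_nonneg (f1 x)
    have : m * r ≤ 1 := by nlinarith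
    nlinarith [mul_pos hm hr]
  have := Real.add_one_le_exp |z|
  have := abs_add_le z (m * r * f1 x)
  linarith

lemma f1_sub (h : Cls f f1 f2 e) (hm : 0 < m) (hm1 : m ≤ 1) (hr : 0 < r) (hr1 : r ≤ 1)
    (x z : ℝ) : |f1 (Yf f1 m r x z) - f1 x| ≤ r * Real.exp |z| :=
  (h.lip1 _ _).trans (Yf_sub h hm hm1 hr hr1 x z)

lemma integrable_f_Y (h : Cls f f1 f2 e) (hm : 0 < m) (hm1 : m ≤ 1) (hr : 0 < r) (hr1 : r ≤ 1)
    (x : ℝ) : Integrable (fun z => f (Yf f1 m r x z)) gam := by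
  have hc := h.cont.comp (Yf_cont (f1 := f1) (m := m) (r := r) (x := x))
  refine int_dom hc.measurable (|f 0| + |x| + 1) 1 fun z => ?_
  refine (h.growth _).trans ?_
  have h1 := Yf_sub h hm hm1 hr hr1 x z
  have h2 := abs_sub_abs_le_abs_sub (Yf f1 m r x z) x
  have h3 := Real.one_le_exp (abs_nonneg z)
  rw [one_mul]
  nlinarith [abs_nonneg (f 0), abs_nonneg x]

lemma integrable_f1_Y (h : Cls f f1 f2 e) (x : ℝ) :
    Integrable (fun z => f1 (Yf f1 m r x z)) gam := by
  have hc := h.cont1.comp (Yf_cont (f1 := f1) (m := m) (r := r) (x := x))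
  refine int_dom hc.measurable 1 0 fun z => ?_
  simpa using h.b1 _

def C1 : ℝ := CS ^ 2 * Real.exp CS * KK 4

lemma est1 (h : Cls f f1 f2 e) (hm : 0 < m) (hm1 : m ≤ 1) (hr : 0 < r) (hr1 : r ≤ 1)
    (x : ℝ) : Pst m r f x ≤ ∫ z, f (Yf f1 m r x z) ∂gam - m * r ^ 2 * f1 x ^ 2 / 2 + C1 * r ^ 4 := by
  have hc := Sf_cont h (m := m) (r := r) x
  have hCS := CS_ge
  have hSi : Integrable (Sf f f1 m r x) gam :=
    int_dom hc.measurable (r ^ 2 * CS) 1 fun z => by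
      rw [one_mul]; exact (Sf_bound h hm hm1 hr hr1 x z).1
  have hSv : ∫ z, Sf f f1 m r x z ∂gam
      = ∫ z, f (Yf f1 m r x z) ∂gam - Pst m r f x - m * r ^ 2 * f1 x ^ 2 / 2 := by
    unfold Sf
    rw [integral_sub, integral_sub, integral_sub, integral_const_mul, gam_id]
    · simp
    · exact integrable_f_Y h hm hm1 hr hr1 x
    · exact integrable_const _
    · exact (integrable_f_Y h hm hm1 hr hr1 x).sub (integrable_const _)
    · exact integrable_id_gam.const_mul _
    · exact ((integrable_f_Y h hm hm1 hr hr1 x).sub (integrable_const _)).sub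
        (integrable_id_gam.const_mul _)
    · exact integrable_const _
  have hbd : ∀ z, |(m * Sf f f1 m r x z) ^ 2 * Real.exp (|m * Sf f f1 m r x z|)| ≤
      (m ^ 2 * r ^ 4 * (CS ^ 2 * Real.exp CS)) * Real.exp (4 * |z|) := fun z => by
    rw [abs_of_nonneg (by positivity)]
    have h1 := expS_bound h hm hm1 hr hr1 x z
    have h2 := (Sf_bound h hm hm1 hr hr1 x z).1
    have h3 : Sf f f1 m r x z ^ 2 ≤ (r ^ 2 * CS * Real.exp |z|) ^ 2 := sq_le_sq' (by
      linarith [(abs_le.1 h2).1]) (abs_le.1 h2).2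
    have h4 : Real.exp (4 * |z|) = Real.exp |z| ^ 2 * Real.exp (2 * |z|) := by
      rw [← Real.exp_nat_mul, ← Real.exp_add]; congr 1; push_cast; ring
    rw [h4, mul_pow]
    calc _ ≤ m ^ 2 * (r ^ 2 * CS * Real.exp |z|) ^ 2 * (Real.exp CS * Real.exp (2 * |z|)) := by
          gcongr
      _ = _ := by ring
  have hme : Measurable fun z => (m * Sf f f1 m r x z) ^ 2 * Real.exp (|m * Sf f f1 m r x z|) := by
    have := hc.measurable; fun_prop
  have hi := int_dom hme _ _ hbd
  have hb := (abs_le.1 (integral_le_KK hme hbd)).2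
  have h1 := S_one h hm hm1 (r := r) x
  have h2 : ∫ z, Real.exp (m * Sf f f1 m r x z) ∂gam ≤ ∫ z, ((1 + m * Sf f f1 m r x z) +
      (m * Sf f f1 m r x z) ^ 2 * Real.exp (|m * Sf f f1 m r x z|)) ∂gam :=
    integral_mono (int_w_one h hm hm1 hr hr1 x) (((integrable_const 1).add (hSi.const_mul m)).add hi)
      fun z => exp_quad _
  have h3 : ∫ z, ((1 + m * Sf f f1 m r x z) +
      (m * Sf f f1 m r x z) ^ 2 * Real.exp (|m * Sf f f1 m r x z|)) ∂gam =
      1 + m * ∫ z, Sf f f1 m r x z ∂gam +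
      ∫ z, (m * Sf f f1 m r x z) ^ 2 * Real.exp (|m * Sf f f1 m r x z|) ∂gam := by
    rw [integral_add ?_ hi, integral_add (integrable_const 1) (hSi.const_mul m), integral_const_mul]
    · simp
    · exact (integrable_const 1).add (hSi.const_mul m)
  rw [h1, h3] at h2
  have h5 : m * (Pst m r f x - (∫ z, f (Yf f1 m r x z) ∂gam - m * r ^ 2 * f1 x ^ 2 / 2)) ≤
      m * (m * (C1 * r ^ 4)) := by
    unfold C1
    rw [hSv] at h2
    linarith
  have h6 := le_of_mul_le_mul_left h5 hm
  have h7 : 0 ≤ C1 * r ^ 4 := by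
    have := KK_ge_one (c := 4) (by norm_num)
    unfold C1; positivity
  nlinarith

def C2 : ℝ := CE * KK 4

lemma est2 (h : Cls f f1 f2 e) (hm : 0 < m) (hm1 : m ≤ 1) (hr : 0 < r) (hr1 : r ≤ 1)
    (x : ℝ) : |∫ z, f1 (Yf f1 m r x z) ∂gam - U1 f f1 m r x| ≤ C2 * r ^ 3 := by
  have hc := (Sf_cont h (m := m) (r := r) x).measurable
  have hc1 : Measurable fun z => f1 (Yf f1 m r x z) :=
    (h.cont1.comp (Yf_cont (f1 := f1) (m := m) (r := r) (x := x))).measurable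
  have hw := int_w_one h hm hm1 hr hr1 x
  have hf := int_w h hm hm1 hr hr1 x hc1 (C := 1) (c := 0) (fun z => by simpa using h.b1 _)
  have h1 : ∫ z, f1 (Yf f1 m r x z) ∂gam - U1 f f1 m r x
      = ∫ z, -((f1 (Yf f1 m r x z) - f1 x) * (Real.exp (m * Sf f f1 m r x z) - 1)) ∂gam := by
    have h2 : ∀ z, -((f1 (Yf f1 m r x z) - f1 x) * (Real.exp (m * Sf f f1 m r x z) - 1))
      = f1 (Yf f1 m r x z) - f1 (Yf f1 m r x z) * Real.exp (m * Sf f f1 m r x z)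
        + (f1 x * Real.exp (m * Sf f f1 m r x z) - f1 x) := fun z => by ring
    simp_rw [h2]
    rw [integral_add, integral_sub, integral_sub, integral_const_mul, S_one h hm hm1 x, U1]
    · simp
    · exact hw.const_mul _
    · exact integrable_const _
    · exact integrable_f1_Y h x
    · exact hf
    · exact (integrable_f1_Y h x).sub hf
    · exact (hw.const_mul _).sub (integrable_const _)
  rw [h1]
  have := integral_le_KK (g := fun z => -((f1 (Yf f1 m r x z) - f1 x) *
      (Real.exp (m * Sf f f1 m r x z) - 1))) (C := r ^ 3 * CE) (c := 4)
      (((hc1.sub_const _).mul (((hc.const_mul m).exp).sub_const 1)).neg) (fun z => by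
    rw [abs_neg, abs_mul]
    have h4 : Real.exp (4 * |z|) = Real.exp |z| * Real.exp (3 * |z|) := by
      rw [← Real.exp_add]; congr 1; ring
    have hCE := CE_pos
    rw [h4]
    calc _ ≤ (r * Real.exp |z|) * (r ^ 2 * CE * Real.exp (3 * |z|)) := by
          gcongr
          · exact f1_sub h hm hm1 hr hr1 x z
          · exact expS_sub h hm hm1 hr hr1 x z
      _ = _ := by ring)
  refine this.trans (le_of_eq ?_)
  unfold C2; ring

def C3 : ℝ := Real.exp CS * KK 3

lemma est3 (h : Cls f f1 f2 e) (hm : 0 < m) (hm1 : m ≤ 1) (hr : 0 < r) (hr1 : r ≤ 1)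
    (x : ℝ) : |U1 f f1 m r x - f1 x| ≤ C3 * r := by
  have hc := (Sf_cont h (m := m) (r := r) x).measurable
  have hc1 : Measurable fun z => f1 (Yf f1 m r x z) :=
    (h.cont1.comp (Yf_cont (f1 := f1) (m := m) (r := r) (x := x))).measurable
  have hw := int_w_one h hm hm1 hr hr1 x
  have hf := int_w h hm hm1 hr hr1 x hc1 (C := 1) (c := 0) (fun z => by simpa using h.b1 _)
  have h1 : U1 f f1 m r x - f1 x
      = ∫ z, (f1 (Yf f1 m r x z) - f1 x) * Real.exp (m * Sf f f1 m r x z) ∂gam := by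
    simp_rw [sub_mul]
    rw [integral_sub hf (hw.const_mul _), integral_const_mul, S_one h hm hm1 x, U1]
    simp
  rw [h1]
  have := integral_le_KK (g := fun z => (f1 (Yf f1 m r x z) - f1 x) *
      (Real.exp (m * Sf f f1 m r x z))) (C := r * Real.exp CS) (c := 3)
      ((hc1.sub_const _).mul (hc.const_mul m).exp) (fun z => by
    rw [abs_mul, abs_of_pos (Real.exp_pos (m * _))]
    have h4 : Real.exp (3 * |z|) = Real.exp |z| * Real.exp (2 * |z|) := by
      rw [← Real.exp_add]; congr 1; ring
    rw [h4]
    calc _ ≤ (r * Real.exp |z|) * (Real.exp CS * Real.exp (2 * |z|)) := by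
          gcongr
          · exact f1_sub h hm hm1 hr hr1 x z
          · exact expS_bound' h hm hm1 hr hr1 x z
      _ = _ := by ring)
  refine this.trans (le_of_eq ?_)
  unfold C3; ring

def C4 : ℝ := 1 + CE * KK 4 + Real.exp CS * KK 4

lemma C4_ge : 1 ≤ C4 := by
  have h1 := KK_ge_one (c := 4) (by norm_num)
  have h2 := CE_pos
  have : 0 ≤ CE * KK 4 + Real.exp CS * KK 4 := by positivity
  unfold C4; linarith

lemma Yf_dom (h : Cls f f1 f2 e) (hm : 0 < m) (hm1 : m ≤ 1) (hr : 0 < r) (hr1 : r ≤ 1)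
    (x z : ℝ) : |Yf f1 m r x z ^ 2| ≤ (|x| + 1) ^ 2 * Real.exp (2 * |z|) := by
  have h1 := Yf_sub h hm hm1 hr hr1 x z
  have h2 := abs_sub_abs_le_abs_sub (Yf f1 m r x z) x
  have h3 := Real.one_le_exp (abs_nonneg z)
  have h4 : |Yf f1 m r x z| ≤ (|x| + 1) * Real.exp |z| := by nlinarith [abs_nonneg x]
  have h5 : Real.exp (2 * |z|) = Real.exp |z| ^ 2 := by
    rw [← Real.exp_nat_mul]; congr 1
  rw [abs_pow, h5, ← mul_pow]
  gcongr

lemma est4 (h : Cls f f1 f2 e) (hm : 0 < m) (hm1 : m ≤ 1) (hr : 0 < r) (hr1 : r ≤ 1)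
    (x : ℝ) : ∫ z, Yf f1 m r x z ^ 2 * Real.exp (m * Sf f f1 m r x z) ∂gam
      ≤ x ^ 2 + C4 * r ^ 2 * (3 + x ^ 2) := by
  have hc := (Sf_cont h (m := m) (r := r) x).measurable
  have hY := (Yf_cont (f1 := f1) (m := m) (r := r) (x := x)).measurable
  have hw := int_w_one h hm hm1 hr hr1 x
  have hRm : Measurable fun z => Yf f1 m r x z - x := hY.sub_const x
  have hR := fun z => Yf_sub h hm hm1 hr hr1 x z
  have hRi := int_w h hm hm1 hr hr1 x hRm (C := r) (c := 1) (fun z => by simpa using hR z)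
  have hR2b : ∀ z, |(Yf f1 m r x z - x) ^ 2| ≤ r ^ 2 * Real.exp (2 * |z|) := fun z => by
    have h5 : Real.exp (2 * |z|) = Real.exp |z| ^ 2 := by
      rw [← Real.exp_nat_mul]; congr 1
    rw [abs_pow, h5, ← mul_pow]
    have := hR z
    gcongr
  have hR2i := int_w h hm hm1 hr hr1 x (hRm.pow_const 2) hR2b
  have h1 : ∫ z, Yf f1 m r x z ^ 2 * Real.exp (m * Sf f f1 m r x z) ∂gam
     = x ^ 2 + 2 * x * (∫ z, (Yf f1 m r x z - x) * Real.exp (m * Sf f f1 m r x z) ∂gam)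
       + ∫ z, (Yf f1 m r x z - x) ^ 2 * Real.exp (m * Sf f f1 m r x z) ∂gam := by
    have h2 : ∀ z, Yf f1 m r x z ^ 2 * Real.exp (m * Sf f f1 m r x z)
      = (x ^ 2 * Real.exp (m * Sf f f1 m r x z)
        + (2 * x) * ((Yf f1 m r x z - x) * Real.exp (m * Sf f f1 m r x z)))
        + (Yf f1 m r x z - x) ^ 2 * Real.exp (m * Sf f f1 m r x z) := fun z => by ring
    simp_rw [h2]
    rw [integral_add _ hR2i, integral_add (hw.const_mul _) (hRi.const_mul _), integral_const_mul,
      integral_const_mul, S_one h hm hm1 x]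
    · simp
    · exact (hw.const_mul _).add (hRi.const_mul _)
  have hA : |∫ z, (Yf f1 m r x z - x) * Real.exp (m * Sf f f1 m r x z) ∂gam|
      ≤ r ^ 2 * (1 + CE * KK 4) := by
    have hRi0 : Integrable (fun z => Yf f1 m r x z - x) gam :=
      int_dom hRm r 1 (fun z => by simpa using hR z)
    have hmm : Measurable fun z => (Yf f1 m r x z - x) * (Real.exp (m * Sf f f1 m r x z) - 1) := by
      fun_prop
    have hbb : ∀ z, |(Yf f1 m r x z - x) * (Real.exp (m * Sf f f1 m r x z) - 1)| ≤
        (r ^ 2 * CE) * Real.exp (4 * |z|) := fun z => by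
      rw [abs_mul]
      have h4 : Real.exp (4 * |z|) = Real.exp |z| * Real.exp (3 * |z|) := by
        rw [← Real.exp_add]; congr 1; ring
      have hCE := CE_pos
      rw [h4]
      calc _ ≤ (r * Real.exp |z|) * (r ^ 2 * CE * Real.exp (3 * |z|)) := by
            gcongr
            · exact hR z
            · exact expS_sub h hm hm1 hr hr1 x z
        _ = r * ((r ^ 2 * CE) * (Real.exp |z| * Real.exp (3 * |z|))) := by ring
        _ ≤ 1 * ((r ^ 2 * CE) * (Real.exp |z| * Real.exp (3 * |z|))) := by gcongr
        _ = _ := by ring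
    have h2 : ∫ z, (Yf f1 m r x z - x) * Real.exp (m * Sf f f1 m r x z) ∂gam
        = ∫ z, (Yf f1 m r x z - x) ∂gam +
          ∫ z, (Yf f1 m r x z - x) * (Real.exp (m * Sf f f1 m r x z) - 1) ∂gam := by
      rw [← integral_add hRi0 (int_dom hmm _ _ hbb)]
      congr 1; ext z; ring
    have h3 : ∫ z, (Yf f1 m r x z - x) ∂gam = m * r ^ 2 * f1 x := by
      have : ∀ z, Yf f1 m r x z - x = r * z + m * r ^ 2 * f1 x := fun z => by unfold Yf; ring
      simp_rw [this]
      rw [integral_add (integrable_id_gam.const_mul _) (integrable_const _), integral_const_mul,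
        gam_id]
      simp
    have h4 : |m * r ^ 2 * f1 x| ≤ r ^ 2 := by
      rw [abs_mul, abs_of_pos (by positivity)]
      have := h.b1 x
      have h5 := abs_nonneg (f1 x)
      have h6 : m * r ^ 2 ≤ r ^ 2 := by nlinarith [sq_nonneg r]
      nlinarith [sq_nonneg r]
    have h5 := integral_le_KK hmm hbb
    rw [h2, h3]
    refine (abs_add_le _ _).trans ?_
    nlinarith
  have hB : ∫ z, (Yf f1 m r x z - x) ^ 2 * Real.exp (m * Sf f f1 m r x z) ∂gam
      ≤ r ^ 2 * (Real.exp CS * KK 4) := by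
    have := integral_le_KK (g := fun z => (Yf f1 m r x z - x) ^ 2 * Real.exp (m * Sf f f1 m r x z))
      (C := r ^ 2 * Real.exp CS) (c := 4) (by fun_prop) (fun z => by
        rw [abs_mul, abs_of_pos (Real.exp_pos (m * _))]
        have h4 : Real.exp (4 * |z|) = Real.exp (2 * |z|) * Real.exp (2 * |z|) := by
          rw [← Real.exp_add]; congr 1; ring
        rw [h4]
        calc _ ≤ (r ^ 2 * Real.exp (2 * |z|)) * (Real.exp CS * Real.exp (2 * |z|)) := by
              gcongr
              · exact hR2b z
              · exact expS_bound' h hm hm1 hr hr1 x z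
          _ = _ := by ring)
    have := (abs_le.1 this).2
    linarith
  rw [h1]
  set I := ∫ z, (Yf f1 m r x z - x) * Real.exp (m * Sf f f1 m r x z) ∂gam
  have h7 : 2 * x * I ≤ (1 + x ^ 2) * (r ^ 2 * (1 + CE * KK 4)) := by
    have h8 : 2 * x * I ≤ 2 * |x| * |I| := by
      have := le_abs_self (2 * x * I)
      rwa [abs_mul, abs_mul, abs_two] at this
    refine h8.trans ?_
    have h9 : 2 * |x| ≤ 1 + x ^ 2 := by
      have := sq_abs x
      nlinarith [sq_nonneg (|x| - 1)]
    gcongr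
  have hk := KK_ge_one (c := 4) (by norm_num)
  have hk2 := CE_pos
  have : 0 ≤ r ^ 2 * (1 + CE * KK 4) := by positivity
  have : 0 ≤ r ^ 2 * (Real.exp CS * KK 4) := by positivity
  unfold C4
  nlinarith [sq_nonneg x]

end step

section step
variable {f f1 f2 : ℝ → ℝ} {e m r : ℝ}

lemma Pst_deriv (h : Cls f f1 f2 e) (hm : 0 < m) (hm1 : m ≤ 1) (x : ℝ) :
    HasDerivAt (Pst m r f) (U1 f f1 m r x) x := by
  have h1 := gam_hasDerivAt (φ := fun x => Real.exp (m * f x))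
    (φ' := fun x => m * (f1 x * Real.exp (m * f x))) (C := Real.exp |f 0|) (c := 1) (r := r)
    (fun x => by
      have := ((h.d1 x).const_mul m).exp
      exact this.congr_deriv (by ring)) zero_le_one (fun x => exp_dom h hm.le hm1 x)
    (fun x => by
      have h2 := exp_dom h hm.le hm1 x
      have h3 := h.b1 x
      rw [abs_mul, abs_mul, abs_of_pos hm]
      have h4 := abs_nonneg (Real.exp (m * f x))
      have h5 : m * |f1 x| ≤ 1 := by nlinarith [abs_nonneg (f1 x)]
      nlinarith) x
  have hZ := Z_pos (r := r) h hm.le hm1 x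
  have h2 := (h1.log hZ.ne').const_mul m⁻¹
  unfold Pst
  refine h2.congr_deriv ?_
  rw [integral_const_mul, U1, ← tilt_shift h hm hm1 x f1]
  generalize (∫ z, Real.exp (m * f (x + z * r)) ∂gam) = Z at *
  generalize (∫ z, f1 (x + z * r) * Real.exp (m * f (x + z * r)) ∂gam) = N at *
  field_simp

lemma U1_deriv (h : Cls f f1 f2 e) (hm : 0 < m) (hm1 : m ≤ 1) (hr : 0 < r) (hr1 : r ≤ 1) (x : ℝ) :
    HasDerivAt (U1 f f1 m r) (U2 f f1 f2 m r x) x := by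
  have hZd := gam_hasDerivAt (φ := fun x => Real.exp (m * f x))
    (φ' := fun x => m * (f1 x * Real.exp (m * f x))) (C := Real.exp |f 0|) (c := 1) (r := r)
    (fun x => by
      have := ((h.d1 x).const_mul m).exp
      exact this.congr_deriv (by ring)) zero_le_one (fun x => exp_dom h hm.le hm1 x)
    (fun x => by
      have h2 := exp_dom h hm.le hm1 x
      have h3 := h.b1 x
      rw [abs_mul, abs_mul, abs_of_pos hm]
      have h4 := abs_nonneg (Real.exp (m * f x))
      have h5 : m * |f1 x| ≤ 1 := by nlinarith [abs_nonneg (f1 x)]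
      nlinarith) x
  have hNd := gam_hasDerivAt (φ := fun x => f1 x * Real.exp (m * f x))
    (φ' := fun x => (f2 x + m * f1 x ^ 2) * Real.exp (m * f x)) (C := Real.exp |f 0|) (c := 1)
    (r := r)
    (fun x => by
      have := (h.d2 x).mul (((h.d1 x).const_mul m).exp)
      exact this.congr_deriv (by ring)) zero_le_one (fun x => by
      have h2 := exp_dom h hm.le hm1 x
      have h3 := h.b1 x
      rw [abs_mul]
      have h4 := abs_nonneg (Real.exp (m * f x))
      nlinarith)
    (fun x => by
      have h2 := exp_dom h hm.le hm1 x
      have h3 := h.b2 x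
      have h5 := h.f2_nonneg x
      rw [abs_mul, abs_of_nonneg (by positivity)]
      have h4 := abs_nonneg (Real.exp (m * f x))
      have h6 : f2 x + m * f1 x ^ 2 ≤ 1 := by nlinarith [sq_nonneg (f1 x)]
      nlinarith) x
  have hZ := Z_pos (r := r) h hm.le hm1 x
  have hd := hNd.div hZd hZ.ne'
  have hU : U1 f f1 m r = fun x => (∫ z, f1 (x + z * r) * Real.exp (m * f (x + z * r)) ∂gam) /
      (∫ z, Real.exp (m * f (x + z * r)) ∂gam) := by
    ext x; rw [U1, ← tilt_shift h hm hm1 x f1]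
  rw [integral_const_mul] at hd
  have hc1 : Measurable fun z => f1 (Yf f1 m r x z) :=
    (h.cont1.comp (Yf_cont (f1 := f1) (m := m) (r := r) (x := x))).measurable
  have hc2 : Measurable fun z => f2 (Yf f1 m r x z) :=
    (h.meas2.comp (Yf_cont (f1 := f1) (m := m) (r := r) (x := x)).measurable)
  have hV : U2 f f1 f2 m r x =
      (∫ z, (f2 (x + z * r) + m * f1 (x + z * r) ^ 2) * Real.exp (m * f (x + z * r)) ∂gam) /
      (∫ z, Real.exp (m * f (x + z * r)) ∂gam) - m * U1 f f1 m r x ^ 2 := by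
    rw [tilt_shift h hm hm1 x (fun x => f2 x + m * f1 x ^ 2), U2, mul_sub, ← integral_const_mul,
      add_sub_assoc', ← integral_add]
    · congr 2; ext z; ring
    · exact int_w h hm hm1 hr hr1 x hc2 (C := 1) (c := 0) (fun z => by simpa using h.abs_f2 _)
    · refine (int_w h hm hm1 hr hr1 x (hc1.pow_const 2) (C := 1) (c := 0) (fun z => ?_)).const_mul m
      have := h.b1 (Yf f1 m r x z)
      simp only [zero_mul, Real.exp_zero, mul_one]
      rw [abs_pow]
      exact pow_le_one₀ (abs_nonneg _) this
  have hUx := congrFun hU x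
  rw [hV, hUx, hU]
  refine hd.congr_deriv ?_
  generalize (∫ z, Real.exp (m * f (x + z * r)) ∂gam) = Z at *
  generalize (∫ z, f1 (x + z * r) * Real.exp (m * f (x + z * r)) ∂gam) = N at *
  generalize (∫ z, (f2 (x + z * r) + m * f1 (x + z * r) ^ 2) *
    Real.exp (m * f (x + z * r)) ∂gam) = M at *
  have := hZ.ne'
  field_simp

lemma U1_var (h : Cls f f1 f2 e) (hm : 0 < m) (hm1 : m ≤ 1) (hr : 0 < r) (hr1 : r ≤ 1) (x : ℝ) :
    U1 f f1 m r x ^ 2 ≤ ∫ z, f1 (Yf f1 m r x z) ^ 2 * Real.exp (m * Sf f f1 m r x z) ∂gam := by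
  have hc1 : Measurable fun z => f1 (Yf f1 m r x z) :=
    (h.cont1.comp (Yf_cont (f1 := f1) (m := m) (r := r) (x := x))).measurable
  have hw := int_w_one h hm hm1 hr hr1 x
  have hf := int_w h hm hm1 hr hr1 x hc1 (C := 1) (c := 0) (fun z => by simpa using h.b1 _)
  have hf2 := int_w h hm hm1 hr hr1 x (hc1.pow_const 2) (C := 1) (c := 0) (fun z => by
      have := h.b1 (Yf f1 m r x z)
      simp only [zero_mul, Real.exp_zero, mul_one]
      rw [abs_pow]
      exact pow_le_one₀ (abs_nonneg _) this)
  set u := U1 f f1 m r x with hu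
  have h0 : 0 ≤ ∫ z, (f1 (Yf f1 m r x z) - u) ^ 2 * Real.exp (m * Sf f f1 m r x z) ∂gam :=
    integral_nonneg fun z => by positivity
  have h1 : ∀ z, (f1 (Yf f1 m r x z) - u) ^ 2 * Real.exp (m * Sf f f1 m r x z)
    = f1 (Yf f1 m r x z) ^ 2 * Real.exp (m * Sf f f1 m r x z)
      - (2 * u) * (f1 (Yf f1 m r x z) * Real.exp (m * Sf f f1 m r x z))
      + u ^ 2 * Real.exp (m * Sf f f1 m r x z) := fun z => by ring
  simp_rw [h1] at h0
  have hs : Integrable (fun z => f1 (Yf f1 m r x z) ^ 2 * Real.exp (m * Sf f f1 m r x z)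
      - (2 * u) * (f1 (Yf f1 m r x z) * Real.exp (m * Sf f f1 m r x z))) gam :=
    hf2.sub (hf.const_mul _)
  rw [integral_add hs (hw.const_mul _), integral_sub hf2 (hf.const_mul _),
    integral_const_mul, integral_const_mul, S_one h hm hm1 x,
    show ∫ z, f1 (Yf f1 m r x z) * Real.exp (m * Sf f f1 m r x z) ∂gam = u from rfl] at h0
  nlinarith

lemma Cls_step (h : Cls f f1 f2 e) (he : 0 ≤ e) (hm : 0 < m) (hm1 : m ≤ 1) (hr : 0 < r)
    (hr1 : r ≤ 1) : Cls (Pst m r f) (U1 f f1 m r) (U2 f f1 f2 m r) (e * (1 + C4 * r ^ 2)) := by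
  have hc1 : ∀ x, Measurable fun z => f1 (Yf f1 m r x z) := fun x =>
    (h.cont1.comp (Yf_cont (f1 := f1) (m := m) (r := r) (x := x))).measurable
  have hc2 : ∀ x, Measurable fun z => f2 (Yf f1 m r x z) := fun x =>
    (h.meas2.comp (Yf_cont (f1 := f1) (m := m) (r := r) (x := x)).measurable)
  have hw := fun x => int_w_one h hm hm1 hr hr1 x
  have hf := fun x => int_w h hm hm1 hr hr1 x (hc1 x) (C := 1) (c := 0)
    (fun z => by simpa using h.b1 _)
  have hf2 := fun x => int_w h hm hm1 hr hr1 x ((hc1 x).pow_const 2) (C := 1) (c := 0) (fun z => by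
      have := h.b1 (Yf f1 m r x z)
      simp only [zero_mul, Real.exp_zero, mul_one]
      rw [abs_pow]
      exact pow_le_one₀ (abs_nonneg _) this)
  have hg := fun x => int_w h hm hm1 hr hr1 x (hc2 x) (C := 1) (c := 0)
    (fun z => by simpa using h.abs_f2 _)
  refine ⟨fun x => Pst_deriv h hm hm1 x, fun x => U1_deriv h hm hm1 hr hr1 x, fun x => ?_,
    fun x => ?_, fun x => ?_⟩
  · rw [abs_le]
    have h1 := S_one h hm hm1 (r := r) x
    constructor
    · have : ∫ z, -Real.exp (m * Sf f f1 m r x z) ∂gam ≤ U1 f f1 m r x :=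
        integral_mono (hw x).neg (hf x) fun z => by
          have := (abs_le.1 (h.b1 (Yf f1 m r x z))).1
          have := Real.exp_pos (m * Sf f f1 m r x z)
          simp only; nlinarith
      rwa [integral_neg, h1] at this
    · have : U1 f f1 m r x ≤ ∫ z, Real.exp (m * Sf f f1 m r x z) ∂gam :=
        integral_mono (hf x) (hw x) fun z => by
          have := (abs_le.1 (h.b1 (Yf f1 m r x z))).2
          have := Real.exp_pos (m * Sf f f1 m r x z)
          simp only; nlinarith
      rwa [h1] at this
  · have hv := U1_var h hm hm1 hr hr1 x
    have h1 : ∫ z, (f2 (Yf f1 m r x z) * Real.exp (m * Sf f f1 m r x z) +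
        f1 (Yf f1 m r x z) ^ 2 * Real.exp (m * Sf f f1 m r x z)) ∂gam ≤
        ∫ z, Real.exp (m * Sf f f1 m r x z) ∂gam :=
      integral_mono ((hg x).add (hf2 x)) (hw x) fun z => by
        have := h.b2 (Yf f1 m r x z)
        have := Real.exp_pos (m * Sf f f1 m r x z)
        simp only; nlinarith
    rw [integral_add (hg x) (hf2 x), S_one h hm hm1 (r := r) x] at h1
    unfold U2
    nlinarith
  · have hv := U1_var h hm hm1 hr hr1 x
    set M := ∫ z, Yf f1 m r x z ^ 2 * Real.exp (m * Sf f f1 m r x z) ∂gam with hM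
    have hMi : Integrable (fun z => Yf f1 m r x z ^ 2 * Real.exp (m * Sf f f1 m r x z)) gam :=
      int_w h hm hm1 hr hr1 x ((Yf_cont.measurable).pow_const 2)
        (fun z => Yf_dom h hm hm1 hr hr1 x z)
    have hM4 : M ≤ _ := est4 h hm hm1 hr hr1 x
    have h1 : ∫ z, (Real.exp (-(2 * e * (3 + M))) * ((1 + 2 * e * M) *
        Real.exp (m * Sf f f1 m r x z) -
        (2 * e) * (Yf f1 m r x z ^ 2 * Real.exp (m * Sf f f1 m r x z)))) ∂gam ≤
        ∫ z, f2 (Yf f1 m r x z) * Real.exp (m * Sf f f1 m r x z) ∂gam := by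
      refine integral_mono ((((hw x).const_mul _).sub (hMi.const_mul _)).const_mul _) (hg x)
        fun z => ?_
      simp only
      have h2 := h.lo (Yf f1 m r x z)
      have h3 := Real.add_one_le_exp (2 * e * M - 2 * e * Yf f1 m r x z ^ 2)
      have h4 : Real.exp (-(2 * e * (3 + Yf f1 m r x z ^ 2))) = Real.exp (-(2 * e * (3 + M))) *
          Real.exp (2 * e * M - 2 * e * Yf f1 m r x z ^ 2) := by
        rw [← Real.exp_add]; congr 1; ring
      calc _ = Real.exp (-(2 * e * (3 + M))) * (2 * e * M - 2 * e * Yf f1 m r x z ^ 2 + 1) *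
            Real.exp (m * Sf f f1 m r x z) := by ring
        _ ≤ Real.exp (-(2 * e * (3 + M))) * Real.exp (2 * e * M - 2 * e * Yf f1 m r x z ^ 2) *
            Real.exp (m * Sf f f1 m r x z) := by gcongr
        _ = Real.exp (-(2 * e * (3 + Yf f1 m r x z ^ 2))) * Real.exp (m * Sf f f1 m r x z) := by
            rw [h4]
        _ ≤ _ := by gcongr
    rw [integral_const_mul, integral_sub ((hw x).const_mul _) (hMi.const_mul _),
      integral_const_mul, integral_const_mul, S_one h hm hm1 (r := r) x, ← hM] at h1
    have h5 : Real.exp (-(2 * (e * (1 + C4 * r ^ 2)) * (3 + x ^ 2))) ≤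
        Real.exp (-(2 * e * (3 + M))) := by
      apply Real.exp_le_exp.2
      nlinarith
    unfold U2
    nlinarith

end step

lemma hasDerivAt_tanh' (x : ℝ) : HasDerivAt Real.tanh (1 - Real.tanh x ^ 2) x := by
  have h1 := (Real.hasDerivAt_sinh x).div (Real.hasDerivAt_cosh x) (Real.cosh_pos x).ne'
  have h2 : Real.tanh = fun x => Real.sinh x / Real.cosh x := by
    ext x; exact Real.tanh_eq_sinh_div_cosh x
  rw [h2]
  refine h1.congr_deriv ?_
  have := (Real.cosh_pos x).ne'
  field_simp

lemma one_sub_tanh_sq (x : ℝ) : 1 - Real.tanh x ^ 2 = 1 / Real.cosh x ^ 2 := by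
  have := (Real.cosh_pos x).ne'
  rw [Real.tanh_eq_sinh_div_cosh]
  have h := Real.cosh_sq_sub_sinh_sq x
  field_simp
  linarith

lemma cosh_le_exp_abs (x : ℝ) : Real.cosh x ≤ Real.exp |x| := by
  rw [Real.cosh_eq]
  have h1 := Real.exp_le_exp.2 (le_abs_self x)
  have h2 := Real.exp_le_exp.2 (neg_le_abs x)
  linarith

lemma lo_tanh (x : ℝ) : Real.exp (-(2 * |x|)) ≤ 1 - Real.tanh x ^ 2 := by
  rw [one_sub_tanh_sq, Real.exp_neg, ← one_div]
  have h := cosh_le_exp_abs x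
  have h1 := Real.cosh_pos x
  have : Real.exp (2 * |x|) = Real.exp |x| ^ 2 := by rw [← Real.exp_nat_mul]; congr 1
  rw [this]
  gcongr

lemma Cls_logcosh : Cls (fun x => Real.log (Real.cosh x)) Real.tanh (fun x => 1 - Real.tanh x ^ 2) 1 := by
  refine ⟨fun x => ?_, hasDerivAt_tanh', fun x => ?_, fun x => by linarith, fun x => ?_⟩
  · have := (Real.hasDerivAt_cosh x).log (Real.cosh_pos x).ne'
    rwa [Real.tanh_eq_sinh_div_cosh]
  · exact (abs_le.2 ⟨(Real.neg_one_lt_tanh x).le, (Real.tanh_lt_one x).le⟩)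
  · refine (Real.exp_le_exp.2 ?_).trans (lo_tanh x)
    have := sq_abs x
    nlinarith [sq_nonneg (|x| - 1)]

lemma Cls.mono {f f1 f2 : ℝ → ℝ} {e e' : ℝ} (h : Cls f f1 f2 e) (he : e ≤ e') :
    Cls f f1 f2 e' :=
  ⟨h.d1, h.d2, h.b1, h.b2, fun x => (Real.exp_le_exp.2 (by nlinarith [sq_nonneg x])).trans (h.lo x)⟩

lemma integrable_affine {f f1 f2 : ℝ → ℝ} {e : ℝ} (h : Cls f f1 f2 e) (a b : ℝ) :
    Integrable (fun z => f (a + z * b)) gam := by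
  have := h.cont
  refine int_dom (by fun_prop) (|f 0| + |a| + |b|) 1 fun z => ?_
  refine (h.growth _).trans ?_
  have h3 := Real.one_le_exp (abs_nonneg z)
  have h4 := abs_le_exp z
  have h5 := abs_add_le a (z * b)
  rw [abs_mul] at h5
  rw [one_mul]
  have h6 := mul_le_mul_of_nonneg_right h4 (abs_nonneg b)
  nlinarith [abs_nonneg (f 0), abs_nonneg a]

/-- variational lower bound of a step -/
lemma Pst_ge {f f1 f2 : ℝ → ℝ} {e m r : ℝ} (h : Cls f f1 f2 e) (hm : 0 < m) (hm1 : m ≤ 1)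
    (x v : ℝ) :
    ∫ z, f ((x + m * r ^ 2 * v) + z * r) ∂gam - m * r ^ 2 * v ^ 2 / 2 ≤ Pst m r f x := by
  set b := m * r * v with hb
  have h1 := exp_Pst (r := r) h hm hm1 x
  rw [gam_shift _ b] at h1
  have h2 : ∀ z, Real.exp (m * f (x + (z + b) * r)) * Real.exp (-b * z - b ^ 2 / 2)
      = Real.exp ((m * f ((x + m * r ^ 2 * v) + z * r) + (-b) * z) - b ^ 2 / 2) := fun z => by
    rw [← Real.exp_add, show x + (z + b) * r = (x + m * r ^ 2 * v) + z * r by rw [hb]; ring]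
    congr 1; ring
  simp_rw [h2] at h1
  have hi := integrable_affine h (x + m * r ^ 2 * v) r
  have hi1 : Integrable (fun z => m * f ((x + m * r ^ 2 * v) + z * r) + (-b) * z) gam :=
    (hi.const_mul m).add (integrable_id_gam.const_mul _)
  have hi2 : Integrable (fun z => (m * f ((x + m * r ^ 2 * v) + z * r) + (-b) * z) - b ^ 2 / 2) gam :=
    hi1.sub (integrable_const _)
  have hE : Integrable (fun z => Real.exp ((m * f ((x + m * r ^ 2 * v) + z * r) + (-b) * z)
      - b ^ 2 / 2)) gam := by
    by_contra hni
    rw [integral_undef hni] at h1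
    exact (Real.exp_pos _).ne' h1
  have h3 := jensen_exp hi2 hE
  rw [← h1] at h3
  have h4 := Real.exp_le_exp.1 h3
  rw [integral_sub hi1 (integrable_const _), integral_add (hi.const_mul m)
    (integrable_id_gam.const_mul _), integral_const_mul, integral_const_mul, gam_id] at h4
  simp only [integral_const, probReal_univ, smul_eq_mul, one_mul, mul_zero, add_zero] at h4
  have h5 : m * (∫ z, f ((x + m * r ^ 2 * v) + z * r) ∂gam - m * r ^ 2 * v ^ 2 / 2) ≤
      m * Pst m r f x := by
    rw [hb] at h4
    refine le_trans (le_of_eq ?_) h4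
    ring
  exact le_of_mul_le_mul_left h5 hm

/-- the convexity gap -/
def Dg (g0 g1 f : ℝ → ℝ) (q y : ℝ) : ℝ := (1 / 2) * g0 (y + q / 2) + (1 / 2) * g1 (y - q / 2) - f y

lemma Dg_step {f f1 f2 g0 g01 g02 g1 g11 g12 : ℝ → ℝ} {e e0 e1 m0 m1 m r : ℝ}
    (h : Cls f f1 f2 e) (h0 : Cls g0 g01 g02 e0) (h1 : Cls g1 g11 g12 e1)
    (hm0 : 0 < m0) (hm01 : m0 ≤ 1) (hm1 : 0 < m1) (hm11 : m1 ≤ 1) (hm : m = (m0 + m1) / 2)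
    (hr : 0 < r) (hr1 : r ≤ 1) (q y : ℝ) :
    Integrable (fun z => Dg g0 g1 f (q + (m0 - m1) * r ^ 2 * f1 y) (Yf f1 m r y z)) gam ∧
    ∫ z, Dg g0 g1 f (q + (m0 - m1) * r ^ 2 * f1 y) (Yf f1 m r y z) ∂gam - C1 * r ^ 4 ≤
      Dg (Pst m0 r g0) (Pst m1 r g1) (Pst m r f) q y := by
  have hm' : 0 < m := by rw [hm]; linarith
  have hm'1 : m ≤ 1 := by rw [hm]; linarith
  have a0 := Pst_ge (r := r) h0 hm0 hm01 (y + q / 2) (f1 y)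
  have a1 := Pst_ge (r := r) h1 hm1 hm11 (y - q / 2) (f1 y)
  have a := est1 h hm' hm'1 hr hr1 y
  have i0 := integrable_affine h0 (y + q / 2 + m0 * r ^ 2 * f1 y) r
  have i1 := integrable_affine h1 (y - q / 2 + m1 * r ^ 2 * f1 y) r
  have i := integrable_f_Y h hm' hm'1 hr hr1 y
  have key : ∀ z, Dg g0 g1 f (q + (m0 - m1) * r ^ 2 * f1 y) (Yf f1 m r y z)
      = (1 / 2) * g0 ((y + q / 2 + m0 * r ^ 2 * f1 y) + z * r) +
        (1 / 2) * g1 ((y - q / 2 + m1 * r ^ 2 * f1 y) + z * r) - f (Yf f1 m r y z) := fun z => by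
    unfold Dg
    have e0 : Yf f1 m r y z + (q + (m0 - m1) * r ^ 2 * f1 y) / 2 =
      (y + q / 2 + m0 * r ^ 2 * f1 y) + z * r := by unfold Yf; rw [hm]; ring
    have e1 : Yf f1 m r y z - (q + (m0 - m1) * r ^ 2 * f1 y) / 2 =
      (y - q / 2 + m1 * r ^ 2 * f1 y) + z * r := by unfold Yf; rw [hm]; ring
    rw [e0, e1]
  simp_rw [key]
  have i01 : Integrable (fun z => (1 / 2) * g0 ((y + q / 2 + m0 * r ^ 2 * f1 y) + z * r) +
        (1 / 2) * g1 ((y - q / 2 + m1 * r ^ 2 * f1 y) + z * r)) gam :=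
    (i0.const_mul _).add (i1.const_mul _)
  refine ⟨i01.sub i, ?_⟩
  rw [integral_sub i01 i, integral_add (i0.const_mul _) (i1.const_mul _), integral_const_mul,
    integral_const_mul]
  unfold Dg
  have : m * r ^ 2 * f1 y ^ 2 / 2 = (m0 * r ^ 2 * f1 y ^ 2 / 2) / 2
      + (m1 * r ^ 2 * f1 y ^ 2 / 2) / 2 := by rw [hm]; ring
  linarith

/-- second moment of the unweighted step -/
lemma Yf_sq {f f1 f2 : ℝ → ℝ} {e m r : ℝ} (h : Cls f f1 f2 e) (hm : 0 < m) (hm1 : m ≤ 1)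
    (hr : 0 < r) (hr1 : r ≤ 1) (y : ℝ) :
    Integrable (fun z => Yf f1 m r y z ^ 2) gam ∧
    3 + ∫ z, Yf f1 m r y z ^ 2 ∂gam ≤ (1 + C4 * r ^ 2) * (3 + y ^ 2) := by
  have hC := C4_ge
  set Y0 := y + m * r ^ 2 * f1 y with hY0
  have key : ∀ z, Yf f1 m r y z ^ 2 = (Y0 ^ 2 + (2 * Y0 * r) * z) + r ^ 2 * z ^ 2 := fun z => by
    rw [hY0]; unfold Yf; ring
  simp_rw [key]
  have i1 : Integrable (fun z : ℝ => Y0 ^ 2 + (2 * Y0 * r) * z) gam :=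
    (integrable_const _).add (integrable_id_gam.const_mul _)
  refine ⟨i1.add (integrable_sq_gam.const_mul _), ?_⟩
  rw [integral_add i1 (integrable_sq_gam.const_mul _), integral_add (integrable_const _)
    (integrable_id_gam.const_mul _), integral_const_mul, integral_const_mul, gam_sq, gam_id]
  simp only [integral_const, probReal_univ, smul_eq_mul, one_mul, mul_zero, add_zero, mul_one]
  have hb : |m * f1 y| ≤ 1 := by
    rw [abs_mul, abs_of_pos hm]
    nlinarith [h.b1 y, abs_nonneg (f1 y)]
  set w := m * f1 y with hw
  have hY : Y0 = y + r ^ 2 * w := by rw [hY0, hw]; ring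
  have hb' := abs_le.1 hb
  have hr2 : 0 < r ^ 2 := by positivity
  have hr3 : r ^ 2 ≤ 1 := by nlinarith
  have hw2 : w ^ 2 ≤ 1 := by nlinarith
  have h1 : Y0 ^ 2 ≤ y ^ 2 + r ^ 2 * (2 + y ^ 2) := by
    rw [hY]
    have : 2 * y * w ≤ y ^ 2 + w ^ 2 := by nlinarith [sq_nonneg (y - w)]
    have h5 : r ^ 2 * w ^ 2 ≤ 1 := by nlinarith [sq_nonneg w]
    have : (y + r ^ 2 * w) ^ 2 = y ^ 2 + r ^ 2 * (2 * y * w + r ^ 2 * w ^ 2) := by ring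
    rw [this]
    have h6 := mul_le_mul_of_nonneg_left (show 2 * y * w + r ^ 2 * w ^ 2 ≤ 2 + y ^ 2 by linarith)
      hr2.le
    linarith
  have h2 : 0 ≤ (C4 - 1) * r ^ 2 * (3 + y ^ 2) := by
    have : 0 ≤ C4 - 1 := by linarith
    positivity
  nlinarith

def c0 (E : ℝ) : ℝ := ∫ z, z ^ 2 * Real.exp (-(4 * E * z ^ 2)) ∂gam

lemma c0_int {E : ℝ} (hE : 0 ≤ E) :
    Integrable (fun z => z ^ 2 * Real.exp (-(4 * E * z ^ 2))) gam := by
  refine int_dom (by fun_prop) 2 1 fun z => ?_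
  rw [abs_of_nonneg (by positivity), one_mul]
  have h1 : Real.exp (-(4 * E * z ^ 2)) ≤ 1 := Real.exp_le_one_iff.2 (by
    have : 0 ≤ 4 * E * z ^ 2 := by positivity
    linarith)
  have := sq_le_exp z
  nlinarith [sq_nonneg z]

lemma c0_pos {E : ℝ} (hE : 0 ≤ E) : 0 < c0 E := by
  unfold c0
  rw [integral_pos_iff_support_of_nonneg (fun z => by positivity) (c0_int hE)]
  have : Function.support (fun z : ℝ => z ^ 2 * Real.exp (-(4 * E * z ^ 2))) = {0}ᶜ := by
    ext z; simp [Function.mem_support]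
  rw [this]
  have : gam {0}ᶜ = 1 := by
    have : NullSingletonClass gam := nullSingletonClass_gaussianReal one_ne_zero
    rw [prob_compl_eq_one_sub (measurableSet_singleton 0), measure_singleton, tsub_zero]
  rw [this]; exact one_pos

/-- variance lower bound along a step -/
lemma var_lower {f f1 f2 : ℝ → ℝ} {e m r E : ℝ} (h : Cls f f1 f2 e) (he0 : 0 ≤ e) (he : e ≤ E)
    (hm : 0 < m) (hm1 : m ≤ 1) (hr : 0 < r) (hr1 : r ≤ 1) (y : ℝ) :
    r ^ 2 * c0 E ^ 2 * Real.exp (-(16 * E * (3 + y ^ 2))) ≤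
      ∫ z, f1 (Yf f1 m r y z) ^ 2 ∂gam - (∫ z, f1 (Yf f1 m r y z) ∂gam) ^ 2 := by
  have hE : 0 ≤ E := he0.trans he
  have hc := (h.cont1.comp (Yf_cont (f1 := f1) (m := m) (r := r) (x := y))).measurable
  have hW : Measurable fun z => f1 (Yf f1 m r y z) := hc
  set W := fun z => f1 (Yf f1 m r y z) with hWd
  have hWb : ∀ z, |W z| ≤ 1 := fun z => h.b1 _
  have hWi : Integrable W gam := integrable_f1_Y h y
  have hW2 : Integrable (fun z => W z ^ 2) gam := int_dom (hW.pow_const 2) 1 0 fun z => by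
    simp only [zero_mul, Real.exp_zero, mul_one]
    rw [abs_pow]; exact pow_le_one₀ (abs_nonneg _) (hWb z)
  have hWz : Integrable (fun z => W z * z) gam := int_dom (hW.mul measurable_id) 1 1 fun z => by
    rw [abs_mul, one_mul, one_mul]
    have := abs_le_exp z
    have := hWb z
    nlinarith [abs_nonneg z]
  set I := ∫ z, W z * z ∂gam with hI
  set M := ∫ z, W z ∂gam with hM
  -- Cauchy-Schwarz in the form of a nonnegative square
  have hCS : I ^ 2 ≤ ∫ z, W z ^ 2 ∂gam - M ^ 2 := by
    have h0 : 0 ≤ ∫ z, (W z - M - I * z) ^ 2 ∂gam := integral_nonneg fun z => by positivity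
    have hk : ∀ z, (W z - M - I * z) ^ 2 = (((W z ^ 2 - (2 * M) * W z) - (2 * I) * (W z * z))
      + (M ^ 2 + (2 * M * I) * z)) + I ^ 2 * z ^ 2 := fun z => by ring
    simp_rw [hk] at h0
    have j1 : Integrable (fun z => W z ^ 2 - (2 * M) * W z) gam := hW2.sub (hWi.const_mul _)
    have j2 : Integrable (fun z => (W z ^ 2 - (2 * M) * W z) - (2 * I) * (W z * z)) gam :=
      j1.sub (hWz.const_mul _)
    have j3 : Integrable (fun z => M ^ 2 + (2 * M * I) * z) gam :=
      (integrable_const _).add (integrable_id_gam.const_mul _)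
    have j0 : ∫ z, (M ^ 2 + (2 * M * I) * z) ∂gam = M ^ 2 := by
      rw [integral_add (integrable_const _) (integrable_id_gam.const_mul _), integral_const_mul,
        gam_id]
      simp
    have j4 : Integrable (fun z => ((W z ^ 2 - (2 * M) * W z) - (2 * I) * (W z * z))
      + (M ^ 2 + (2 * M * I) * z)) gam := j2.add j3
    rw [integral_add j4 (integrable_sq_gam.const_mul _), integral_add j2 j3,
      integral_sub j1 (hWz.const_mul _), integral_sub hW2 (hWi.const_mul _), j0] at h0
    simp only [integral_const_mul, gam_sq, mul_one] at h0
    rw [← hI, ← hM] at h0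
    nlinarith
  have hIl : r * Real.exp (-(8 * E * (3 + y ^ 2))) * c0 E ≤ I := by
    have h1 : I = ∫ z, (W z * z - W 0 * z) ∂gam := by
      rw [integral_sub hWz (integrable_id_gam.const_mul _), integral_const_mul, gam_id, hI]
      simp
    rw [h1, c0, ← integral_const_mul]
    refine integral_mono ((c0_int hE).const_mul _) (hWz.sub (integrable_id_gam.const_mul _))
      fun z => ?_
    simp only
    have eY : Yf f1 m r y z = Yf f1 m r y 0 + z * r := by unfold Yf; ring
    have hlow : ∀ t, |t - Yf f1 m r y 0| ≤ |z| →
        Real.exp (-(8 * E * (3 + y ^ 2))) * Real.exp (-(4 * E * z ^ 2)) ≤ f2 t := by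
      intro t ht
      refine le_trans ?_ (h.lo t)
      rw [← Real.exp_add]
      apply Real.exp_le_exp.2
      have hY0 : |Yf f1 m r y 0 - y| ≤ 1 := by
        have := Yf_sub h hm hm1 hr hr1 y 0
        simp only [abs_zero, Real.exp_zero, mul_one] at this
        linarith
      set p := Yf f1 m r y 0 - y with hp
      set s := t - Yf f1 m r y 0 with hs
      have et : t = y + p + s := by rw [hp, hs]; ring
      have hs2 : s ^ 2 ≤ z ^ 2 := sq_le_sq.2 ht
      have hp2 : p ^ 2 ≤ 1 := by
        have := abs_le.1 hY0; nlinarith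
      have ht2 : t ^ 2 ≤ 4 * y ^ 2 + 4 + 2 * z ^ 2 := by
        rw [et]
        nlinarith [sq_nonneg (y + p - s), sq_nonneg (y - p)]
      have h5 : 2 * e * (3 + t ^ 2) ≤ 2 * E * (3 + t ^ 2) := by
        have : 0 ≤ 3 + t ^ 2 := by positivity
        gcongr
      nlinarith [sq_nonneg y]
    set L := Real.exp (-(8 * E * (3 + y ^ 2))) * Real.exp (-(4 * E * z ^ 2)) with hL
    have goal' : L * r * z ^ 2 ≤ (W z - W 0) * z := by
      rcases lt_trichotomy z 0 with hz | hz | hz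
      · have hlt : Yf f1 m r y z < Yf f1 m r y 0 := by rw [eY]; nlinarith
        obtain ⟨t, ht, hte⟩ := exists_hasDerivAt_eq_slope f1 f2 hlt h.cont1.continuousOn
          (fun x _ => h.d2 x)
        have h3 := hlow t (by
          rw [abs_of_neg (by linarith [ht.2]), abs_of_neg hz]
          have := ht.1
          rw [eY] at this
          nlinarith)
        rw [eq_div_iff (by linarith)] at hte
        have h4 : W 0 - W z = f2 t * (-(z * r)) := by
          rw [hWd]; simp only; rw [← hte, eY]; ring
        have : L * (r * z ^ 2) ≤ f2 t * (r * z ^ 2) := by gcongr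
        nlinarith
      · subst hz; simp
      · have hlt : Yf f1 m r y 0 < Yf f1 m r y z := by rw [eY]; nlinarith
        obtain ⟨t, ht, hte⟩ := exists_hasDerivAt_eq_slope f1 f2 hlt h.cont1.continuousOn
          (fun x _ => h.d2 x)
        have h3 := hlow t (by
          rw [abs_of_pos (by linarith [ht.1]), abs_of_pos hz]
          have := ht.2
          rw [eY] at this
          nlinarith)
        rw [eq_div_iff (by linarith)] at hte
        have h4 : W z - W 0 = f2 t * (z * r) := by
          rw [hWd]; simp only; rw [← hte, eY]; ring
        have : L * (r * z ^ 2) ≤ f2 t * (r * z ^ 2) := by gcongr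
        nlinarith
    calc _ = L * r * z ^ 2 := by rw [hL]; ring
      _ ≤ _ := goal'
      _ = _ := by ring
  refine le_trans ?_ hCS
  have h2 : r ^ 2 * c0 E ^ 2 * Real.exp (-(16 * E * (3 + y ^ 2))) =
      (r * Real.exp (-(8 * E * (3 + y ^ 2))) * c0 E) ^ 2 := by
    rw [mul_pow, mul_pow, ← Real.exp_nat_mul]
    have : ((2 : ℕ) : ℝ) * -(8 * E * (3 + y ^ 2)) = -(16 * E * (3 + y ^ 2)) := by push_cast; ring
    rw [this]; ring
  rw [h2]
  have := c0_pos hE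
  gcongr

def C5 (T : ℝ) : ℝ := C1 + 4 * T * (C3 + T * C2)

lemma C1_nonneg : 0 ≤ C1 := by
  have := KK_ge_one (c := 4) (by norm_num)
  unfold C1; positivity

lemma C2_nonneg : 0 ≤ C2 := by
  have := KK_ge_one (c := 4) (by norm_num)
  have := CE_pos
  unfold C2; positivity

lemma C3_nonneg : 0 ≤ C3 := by
  have := KK_ge_one (c := 3) (by norm_num)
  unfold C3; positivity

lemma C5_nonneg {T : ℝ} (hT : 0 ≤ T) : 0 ≤ C5 T := by
  have := C1_nonneg
  have := C2_nonneg
  have := C3_nonneg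
  unfold C5; positivity

set_option maxHeartbeats 1000000 in
lemma step_main {f f1 f2 g0 g01 g02 g1 g11 g12 : ℝ → ℝ} {e e0 e1 m0 m1 m r : ℝ}
    {E T t c A B κ g err : ℝ}
    (h : Cls f f1 f2 e) (h0 : Cls g0 g01 g02 e0) (h1 : Cls g1 g11 g12 e1)
    (hm0 : 0 < m0) (hm01 : m0 ≤ 1) (hm1 : 0 < m1) (hm11 : m1 ≤ 1) (hm : m = (m0 + m1) / 2)
    (hr : 0 < r) (hr1 : r ≤ 1) (he0 : 0 ≤ e) (he : e ≤ E) (hκ : 16 * E ≤ κ) (hB : 0 ≤ B)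
    (hg : 0 ≤ g) (hc : 0 ≤ c) (hc1 : c ≤ 1) (hA : |A| ≤ T)
    (hA' : |A + (m0 - m1) * r ^ 2| ≤ T) (htT : t ≤ T)
    (H : ∀ q y, |q| ≤ t + r ^ 2 → c * ((q + A * f1 y) ^ 2 + B * Real.exp (-(κ * (3 + y ^ 2)))
      - g * (3 + y ^ 2)) - err ≤ Dg g0 g1 f q y)
    (q y : ℝ) (hq : |q| ≤ t) :
    c * ((q + (A + (m0 - m1) * r ^ 2) * U1 f f1 m r y) ^ 2
      + (B + c0 E ^ 2 * A ^ 2 * r ^ 2) * Real.exp (-((κ * (1 + C4 * r ^ 2)) * (3 + y ^ 2)))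
      - (g * (1 + C4 * r ^ 2)) * (3 + y ^ 2)) - (err + C5 T * r ^ 3) ≤
      Dg (Pst m0 r g0) (Pst m1 r g1) (Pst m r f) q y := by
  have hm' : 0 < m := by rw [hm]; linarith
  have hm'1 : m ≤ 1 := by rw [hm]; linarith
  have hE : 0 ≤ E := he0.trans he
  have hκ0 : 0 ≤ κ := by linarith
  have hT : 0 ≤ T := (abs_nonneg _).trans hA
  obtain ⟨hDi, hD⟩ := Dg_step h h0 h1 hm0 hm01 hm1 hm11 hm hr hr1 q y
  set a := m0 - m1 with ha
  have ha1 : |a| ≤ 1 := abs_le.2 ⟨by linarith, by linarith⟩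
  set q' := q + a * r ^ 2 * f1 y with hq'
  have hq'b : |q'| ≤ t + r ^ 2 := by
    have h2 : |a * r ^ 2 * f1 y| ≤ r ^ 2 := by
      rw [abs_mul, abs_mul, abs_of_nonneg (sq_nonneg r)]
      have := h.b1 y
      have h5 : |a| * |f1 y| ≤ 1 := by nlinarith [abs_nonneg (f1 y), abs_nonneg a]
      nlinarith [sq_nonneg r]
    exact (abs_add_le _ _).trans (by linarith)
  have hW : Measurable fun z => f1 (Yf f1 m r y z) :=
    (h.cont1.comp (Yf_cont (f1 := f1) (m := m) (r := r) (x := y))).measurable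
  have hYm : Measurable fun z => Yf f1 m r y z := Yf_cont.measurable
  obtain ⟨hY2, hY2b⟩ := Yf_sq h hm' hm'1 hr hr1 y
  have hWi : Integrable (fun z => f1 (Yf f1 m r y z)) gam := integrable_f1_Y h y
  have hW2 : Integrable (fun z => f1 (Yf f1 m r y z) ^ 2) gam := int_dom (hW.pow_const 2) 1 0
    fun z => by
      simp only [zero_mul, Real.exp_zero, mul_one]
      rw [abs_pow]; exact pow_le_one₀ (abs_nonneg _) (h.b1 _)
  have hEi : Integrable (fun z => Real.exp (-(κ * (3 + Yf f1 m r y z ^ 2)))) gam :=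
    int_dom (by fun_prop) 1 0 fun z => by
      simp only [zero_mul, Real.exp_zero, mul_one]
      rw [abs_of_pos (Real.exp_pos _)]
      apply Real.exp_le_one_iff.2
      have : 0 ≤ κ * (3 + Yf f1 m r y z ^ 2) := by positivity
      linarith
  have hvar := var_lower h he0 he hm' hm'1 hr hr1 y
  have e2 := est2 h hm' hm'1 hr hr1 y
  have e3 := est3 h hm' hm'1 hr hr1 y
  set M := ∫ z, f1 (Yf f1 m r y z) ∂gam with hM
  set V := ∫ z, f1 (Yf f1 m r y z) ^ 2 ∂gam with hV
  set S := ∫ z, Yf f1 m r y z ^ 2 ∂gam with hS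
  -- Jensen
  have hJ : Real.exp (-((κ * (1 + C4 * r ^ 2)) * (3 + y ^ 2))) ≤
      ∫ z, Real.exp (-(κ * (3 + Yf f1 m r y z ^ 2))) ∂gam := by
    have hi1 : Integrable (fun z => 3 + Yf f1 m r y z ^ 2) gam := (integrable_const _).add hY2
    have hi2 : Integrable (fun z => -(κ * (3 + Yf f1 m r y z ^ 2))) gam := (hi1.const_mul κ).neg
    have := jensen_exp hi2 hEi
    rw [integral_neg, integral_const_mul, integral_add (integrable_const _) hY2] at this
    simp only [integral_const, probReal_univ, smul_eq_mul, one_mul] at this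
    refine le_trans (Real.exp_le_exp.2 ?_) this
    rw [← hS]
    have := mul_le_mul_of_nonneg_left hY2b hκ0
    linarith
  -- integrate the hypothesis
  have hlow : c * (((q' + A * M) ^ 2 + A ^ 2 * (V - M ^ 2))
      + B * (∫ z, Real.exp (-(κ * (3 + Yf f1 m r y z ^ 2))) ∂gam) - g * (3 + S)) - err ≤
      ∫ z, Dg g0 g1 f q' (Yf f1 m r y z) ∂gam := by
    have i1 : Integrable (fun z => q' ^ 2 + (2 * q' * A) * f1 (Yf f1 m r y z)) gam :=
      (integrable_const _).add (hWi.const_mul _)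
    have i2 : Integrable (fun z => (q' ^ 2 + (2 * q' * A) * f1 (Yf f1 m r y z)) +
      A ^ 2 * f1 (Yf f1 m r y z) ^ 2) gam := i1.add (hW2.const_mul _)
    have i3 : Integrable (fun z => ((q' ^ 2 + (2 * q' * A) * f1 (Yf f1 m r y z)) +
      A ^ 2 * f1 (Yf f1 m r y z) ^ 2) + B * Real.exp (-(κ * (3 + Yf f1 m r y z ^ 2)))) gam :=
      i2.add (hEi.const_mul _)
    have i4 : Integrable (fun z => g * 3 + g * Yf f1 m r y z ^ 2) gam :=
      (integrable_const _).add (hY2.const_mul _)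
    have i5 : Integrable (fun z => (((q' ^ 2 + (2 * q' * A) * f1 (Yf f1 m r y z)) +
      A ^ 2 * f1 (Yf f1 m r y z) ^ 2) + B * Real.exp (-(κ * (3 + Yf f1 m r y z ^ 2))))
       - (g * 3 + g * Yf f1 m r y z ^ 2)) gam := i3.sub i4
    have i6 : Integrable (fun z => c * ((((q' ^ 2 + (2 * q' * A) * f1 (Yf f1 m r y z)) +
      A ^ 2 * f1 (Yf f1 m r y z) ^ 2) + B * Real.exp (-(κ * (3 + Yf f1 m r y z ^ 2))))
       - (g * 3 + g * Yf f1 m r y z ^ 2)) - err) gam := (i5.const_mul c).sub (integrable_const _)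
    have hmono := integral_mono i6 hDi fun z => by
      have := H q' (Yf f1 m r y z) hq'b
      simp only
      refine le_trans (le_of_eq ?_) this
      ring
    rw [integral_sub (i5.const_mul c) (integrable_const _), integral_const_mul, integral_sub i3 i4,
      integral_add i2 (hEi.const_mul _), integral_add i1 (hW2.const_mul _),
      integral_add (integrable_const _) (hWi.const_mul _),
      integral_add (integrable_const _) (hY2.const_mul _), integral_const_mul, integral_const_mul,
      integral_const_mul, integral_const_mul g (fun z => Yf f1 m r y z ^ 2), ← hM, ← hV,
      ← hS] at hmono
    simp only [integral_const, probReal_univ, smul_eq_mul, one_mul] at hmono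
    refine le_trans (le_of_eq ?_) hmono
    ring
  -- the mean
  set u := U1 f f1 m r y with hu
  set A' := A + a * r ^ 2 with hA'd
  have hub : |u| ≤ 1 := (Cls_step h he0 hm' hm'1 hr hr1).b1 y
  have hX : |q + A' * u| ≤ 2 * T := by
    have h2 : |A' * u| ≤ T := by
      rw [abs_mul]; nlinarith [abs_nonneg u, abs_nonneg A']
    exact (abs_add_le _ _).trans (by linarith)
  have hdiff : |(q' + A * M) - (q + A' * u)| ≤ (C3 + T * C2) * r ^ 3 := by
    have h2 : (q' + A * M) - (q + A' * u) = -(a * r ^ 2 * (u - f1 y)) + A * (M - u) := by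
      rw [hq', hA'd]; ring
    rw [h2]
    refine (abs_add_le _ _).trans ?_
    rw [abs_neg, abs_mul, abs_mul, abs_mul, abs_of_nonneg (sq_nonneg r)]
    have h3 : |a| * r ^ 2 * |u - f1 y| ≤ 1 * r ^ 2 * (C3 * r) := by
      gcongr
    have h4 : |A| * |M - u| ≤ T * (C2 * r ^ 3) := by gcongr
    linarith
  have hsq : (q + A' * u) ^ 2 - 4 * T * ((C3 + T * C2) * r ^ 3) ≤ (q' + A * M) ^ 2 := by
    set X := q + A' * u
    set Y := q' + A * M
    have h5 : Y ^ 2 ≥ X ^ 2 + 2 * X * (Y - X) := by nlinarith [sq_nonneg (Y - X)]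
    have h6 : |2 * X * (Y - X)| ≤ 2 * (2 * T) * ((C3 + T * C2) * r ^ 3) := by
      rw [abs_mul, abs_mul, abs_two]
      gcongr
    have h7 := (abs_le.1 h6).1
    linarith
  have hfin : c * (((q + A' * u) ^ 2 - 4 * T * ((C3 + T * C2) * r ^ 3)
      + A ^ 2 * (r ^ 2 * c0 E ^ 2 * Real.exp (-((κ * (1 + C4 * r ^ 2)) * (3 + y ^ 2)))))
      + B * Real.exp (-((κ * (1 + C4 * r ^ 2)) * (3 + y ^ 2)))
      - g * ((1 + C4 * r ^ 2) * (3 + y ^ 2))) ≤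
      c * (((q' + A * M) ^ 2 + A ^ 2 * (V - M ^ 2))
      + B * (∫ z, Real.exp (-(κ * (3 + Yf f1 m r y z ^ 2))) ∂gam) - g * (3 + S)) := by
    apply mul_le_mul_of_nonneg_left _ hc
    have h8 : A ^ 2 * (r ^ 2 * c0 E ^ 2 * Real.exp (-((κ * (1 + C4 * r ^ 2)) * (3 + y ^ 2)))) ≤
        A ^ 2 * (V - M ^ 2) := by
      apply mul_le_mul_of_nonneg_left _ (sq_nonneg A)
      refine le_trans ?_ hvar
      apply mul_le_mul_of_nonneg_left _ (by positivity)
      apply Real.exp_le_exp.2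
      have hC := C4_ge
      have h9 : 16 * E ≤ κ * (1 + C4 * r ^ 2) := by
        have : 0 ≤ κ * (C4 * r ^ 2) := by positivity
        linarith
      have := mul_le_mul_of_nonneg_right h9 (show 0 ≤ 3 + y ^ 2 by positivity)
      linarith
    have h10 := mul_le_mul_of_nonneg_left hJ hB
    have h11 := mul_le_mul_of_nonneg_left hY2b hg
    linarith
  have hr4 : C1 * r ^ 4 ≤ C1 * r ^ 3 := by
    apply mul_le_mul_of_nonneg_left _ C1_nonneg
    exact pow_le_pow_of_le_one hr.le hr1 (by norm_num)
  have hcr : c * (4 * T * ((C3 + T * C2) * r ^ 3)) ≤ 4 * T * ((C3 + T * C2) * r ^ 3) := by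
    have := C2_nonneg
    have := C3_nonneg
    have : 0 ≤ 4 * T * ((C3 + T * C2) * r ^ 3) := by positivity
    nlinarith
  unfold C5
  linarith

/-- terminal strong convexity -/
lemma terminal (T η : ℝ) (hT : 0 ≤ T) (hη : 0 < η) :
    ∃ c, 0 < c ∧ c ≤ 1 ∧ ∀ q y, |q| ≤ T → c * (q ^ 2 - η * (3 + y ^ 2)) ≤
      Dg (fun x => Real.log (Real.cosh x)) (fun x => Real.log (Real.cosh x))
        (fun x => Real.log (Real.cosh x)) q y := by
  have key : ∀ q y : ℝ, Dg (fun x => Real.log (Real.cosh x)) (fun x => Real.log (Real.cosh x))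
        (fun x => Real.log (Real.cosh x)) q y =
      (1 / 2) * Real.log (1 + Real.sinh (q / 2) ^ 2 / Real.cosh y ^ 2) := by
    intro q y
    have hp := Real.cosh_pos (y + q / 2)
    have hp' := Real.cosh_pos (y - q / 2)
    have hy := Real.cosh_pos y
    have h1 : 1 + Real.sinh (q / 2) ^ 2 / Real.cosh y ^ 2 =
        Real.cosh (y + q / 2) * Real.cosh (y - q / 2) / Real.cosh y ^ 2 := by
      rw [Real.cosh_add, Real.cosh_sub]
      field_simp
      have h2 := Real.cosh_sq_sub_sinh_sq y
      have h3 := Real.cosh_sq_sub_sinh_sq (q / 2)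
      nlinarith
    rw [h1, Real.log_div (by positivity) (by positivity), Real.log_mul hp.ne' hp'.ne', Real.log_pow]
    unfold Dg
    push_cast
    ring
  set R := Real.exp (2 * (T ^ 2 / η + 1)) with hR
  have hRp : 0 < R := Real.exp_pos _
  refine ⟨1 / (8 * (R + T ^ 2 + 1)), by positivity, ?_, fun q y hq => ?_⟩
  · rw [div_le_one (by positivity)]; nlinarith [sq_nonneg T]
  rw [key]
  have hcy := Real.cosh_pos y
  set u := Real.sinh (q / 2) ^ 2 / Real.cosh y ^ 2 with hu
  have hu0 : 0 ≤ u := by positivity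
  rcases le_or_gt (q ^ 2) (η * (3 + y ^ 2)) with hle | hgt
  · have h1 : 0 ≤ Real.log (1 + u) := Real.log_nonneg (by linarith)
    have h2 : 1 / (8 * (R + T ^ 2 + 1)) * (q ^ 2 - η * (3 + y ^ 2)) ≤ 0 :=
      mul_nonpos_of_nonneg_of_nonpos (by positivity) (by linarith)
    linarith
  · have hq2 : q ^ 2 ≤ T ^ 2 := by
      rw [← sq_abs q]; gcongr
    have hy2 : y ^ 2 ≤ T ^ 2 / η := by
      rw [le_div_iff₀ hη]; nlinarith
    have hya : |y| ≤ T ^ 2 / η + 1 := by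
      have := sq_abs y
      nlinarith [sq_nonneg (|y| - 1), abs_nonneg y]
    have hcR : Real.cosh y ^ 2 ≤ R := by
      have h1 := cosh_le_exp_abs y
      have h2 : Real.cosh y ^ 2 ≤ Real.exp |y| ^ 2 := by gcongr
      refine h2.trans ?_
      rw [← Real.exp_nat_mul, hR]
      apply Real.exp_le_exp.2
      push_cast; linarith
    have hs : (q / 2) ^ 2 ≤ Real.sinh (q / 2) ^ 2 := by
      rw [sq_le_sq]
      rcases le_total 0 (q / 2) with h | h
      · rw [abs_of_nonneg h, abs_of_nonneg (Real.sinh_nonneg_iff.2 h)]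
        exact Real.self_le_sinh_iff.2 h
      · rw [abs_of_nonpos h, abs_of_nonpos (Real.sinh_nonpos_iff.2 h), ← Real.sinh_neg]
        exact Real.self_le_sinh_iff.2 (by linarith)
    set w := (q / 2) ^ 2 / Real.cosh y ^ 2 with hw
    have hw0 : 0 ≤ w := by positivity
    have hwu : w ≤ u := by rw [hw, hu]; gcongr
    have h3 : 1 - (1 + w)⁻¹ ≤ Real.log (1 + w) := Real.one_sub_inv_le_log_of_pos (by linarith)
    have h4 : Real.log (1 + w) ≤ Real.log (1 + u) := Real.log_le_log (by linarith) (by linarith)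
    have h5 : 1 - (1 + w)⁻¹ = (q / 2) ^ 2 / (Real.cosh y ^ 2 + (q / 2) ^ 2) := by
      have : (1 + w) = (Real.cosh y ^ 2 + (q / 2) ^ 2) / Real.cosh y ^ 2 := by
        rw [hw]; field_simp
      rw [this]
      have h6 : Real.cosh y ^ 2 + (q / 2) ^ 2 ≠ 0 := by positivity
      rw [inv_div, eq_div_iff h6, sub_mul, div_mul_cancel₀ _ h6]
      ring
    have h6 : (q / 2) ^ 2 / (R + T ^ 2 + 1) ≤ (q / 2) ^ 2 / (Real.cosh y ^ 2 + (q / 2) ^ 2) := by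
      apply div_le_div_of_nonneg_left (by positivity) (by positivity)
      nlinarith
    have h7 : 1 / (8 * (R + T ^ 2 + 1)) * (q ^ 2 - η * (3 + y ^ 2)) ≤
        1 / (8 * (R + T ^ 2 + 1)) * q ^ 2 := by
      apply mul_le_mul_of_nonneg_left _ (by positivity)
      have : 0 ≤ η * (3 + y ^ 2) := by positivity
      linarith
    have h8 : 1 / (8 * (R + T ^ 2 + 1)) * q ^ 2 = (1 / 2) * ((q / 2) ^ 2 / (R + T ^ 2 + 1)) := by
      field_simp; norm_num; ring
    linarith

/-! ### The recursion -/

def Fr (m r : ℕ → ℝ) : ℕ → ℝ → ℝ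
  | 0 => fun x => Real.log (Real.cosh x)
  | n + 1 => Pst (m n) (r n) (Fr m r n)

def Fr1 (m r : ℕ → ℝ) : ℕ → ℝ → ℝ
  | 0 => Real.tanh
  | n + 1 => U1 (Fr m r n) (Fr1 m r n) (m n) (r n)

def Fr2 (m r : ℕ → ℝ) : ℕ → ℝ → ℝ
  | 0 => fun x => 1 - Real.tanh x ^ 2
  | n + 1 => U2 (Fr m r n) (Fr1 m r n) (Fr2 m r n) (m n) (r n)

def er (r : ℕ → ℝ) : ℕ → ℝ
  | 0 => 1
  | n + 1 => er r n * (1 + C4 * r n ^ 2)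

def sr (r : ℕ → ℝ) (n : ℕ) : ℝ := ∑ j ∈ Finset.range n, r j ^ 2

def Ar (m0 m1 r : ℕ → ℝ) (n : ℕ) : ℝ := ∑ j ∈ Finset.range n, (m0 j - m1 j) * r j ^ 2

lemma er_ge (r : ℕ → ℝ) (n : ℕ) : 1 ≤ er r n := by
  induction n with
  | zero => exact le_rfl
  | succ n ih =>
    have := C4_ge
    have : 0 ≤ C4 * r n ^ 2 := by positivity
    rw [er]; nlinarith

lemma er_le (r : ℕ → ℝ) (n : ℕ) : er r n ≤ Real.exp (C4 * sr r n) := by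
  induction n with
  | zero => simp [er, sr]
  | succ n ih =>
    have := C4_ge
    have h1 : 0 ≤ C4 * r n ^ 2 := by positivity
    have h2 := Real.add_one_le_exp (C4 * r n ^ 2)
    have h3 : Real.exp (C4 * sr r (n + 1)) = Real.exp (C4 * sr r n) * Real.exp (C4 * r n ^ 2) := by
      rw [← Real.exp_add, sr, sr, Finset.sum_range_succ]; congr 1; ring
    rw [er, h3]
    have h4 := er_ge r n
    gcongr
    linarith

lemma sr_mono (r : ℕ → ℝ) {n N : ℕ} (h : n ≤ N) : sr r n ≤ sr r N :=
  Finset.sum_le_sum_of_subset_of_nonneg (Finset.range_mono h) fun i _ _ => sq_nonneg _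

lemma Cls_rec {m r : ℕ → ℝ} (hm : ∀ n, 0 < m n) (hm1 : ∀ n, m n ≤ 1) (hr : ∀ n, 0 < r n)
    (hr1 : ∀ n, r n ≤ 1) (n : ℕ) : Cls (Fr m r n) (Fr1 m r n) (Fr2 m r n) (er r n) := by
  induction n with
  | zero => exact Cls_logcosh
  | succ n ih =>
    exact Cls_step ih (zero_le_one.trans (er_ge r n)) (hm n) (hm1 n) (hr n) (hr1 n)

lemma Ar_le {m0 m1 r : ℕ → ℝ} (hm0 : ∀ n, 0 < m0 n) (hm01 : ∀ n, m0 n ≤ 1)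
    (hm1 : ∀ n, 0 < m1 n) (hm11 : ∀ n, m1 n ≤ 1) (n : ℕ) : |Ar m0 m1 r n| ≤ sr r n := by
  refine (Finset.abs_sum_le_sum_abs _ _).trans (Finset.sum_le_sum fun j _ => ?_)
  rw [abs_mul, abs_of_nonneg (sq_nonneg (r j))]
  have : |m0 j - m1 j| ≤ 1 := abs_le.2 ⟨by linarith [hm0 j, hm11 j], by linarith [hm01 j, hm1 j]⟩
  nlinarith [sq_nonneg (r j)]

lemma main_rec {m0 m1 m r : ℕ → ℝ} (hm0 : ∀ n, 0 < m0 n) (hm01 : ∀ n, m0 n ≤ 1)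
    (hm1 : ∀ n, 0 < m1 n) (hm11 : ∀ n, m1 n ≤ 1) (hm : ∀ n, m n = (m0 n + m1 n) / 2)
    (hr : ∀ n, 0 < r n) (hr1 : ∀ n, r n ≤ 1) {T E c η : ℝ} (hE : E = Real.exp (C4 * T))
    (hη : 0 < η) (hc : 0 < c) (hc1 : c ≤ 1)
    (hterm : ∀ q y, |q| ≤ T → c * (q ^ 2 - η * (3 + y ^ 2)) ≤
      Dg (fun x => Real.log (Real.cosh x)) (fun x => Real.log (Real.cosh x))
        (fun x => Real.log (Real.cosh x)) q y) (n : ℕ) (hn : sr r n ≤ T) :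
    ∀ q y, |q| ≤ T - sr r n → c * ((q + Ar m0 m1 r n * Fr1 m r n y) ^ 2 +
      (∑ j ∈ Finset.range n, c0 E ^ 2 * Ar m0 m1 r j ^ 2 * r j ^ 2) *
        Real.exp (-((16 * E * er r n) * (3 + y ^ 2))) - (η * er r n) * (3 + y ^ 2))
      - (∑ j ∈ Finset.range n, C5 T * r j ^ 3) ≤ Dg (Fr m0 r n) (Fr m1 r n) (Fr m r n) q y := by
  have hmp : ∀ n, 0 < m n := fun n => by rw [hm]; linarith [hm0 n, hm1 n]
  have hmp1 : ∀ n, m n ≤ 1 := fun n => by rw [hm]; linarith [hm01 n, hm11 n]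
  induction n with
  | zero =>
    intro q y hq
    have := hterm q y (by simpa [sr] using hq)
    simpa [Ar, er, Fr] using this
  | succ n ih =>
    intro q y hq
    have hs : sr r (n + 1) = sr r n + r n ^ 2 := Finset.sum_range_succ _ _
    have hn' : sr r n ≤ T := by nlinarith [sq_nonneg (r n)]
    have hs0 : 0 ≤ sr r (n + 1) := Finset.sum_nonneg fun _ _ => sq_nonneg _
    have hE1 : er r n ≤ E := by
      rw [hE]
      have := C4_ge
      exact (er_le r n).trans (Real.exp_le_exp.2 (by gcongr))
    have hEp : 0 < E := hE ▸ Real.exp_pos _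
    have hA : Ar m0 m1 r (n + 1) = Ar m0 m1 r n + (m0 n - m1 n) * r n ^ 2 :=
      Finset.sum_range_succ _ _
    have hge := er_ge r n
    have := step_main (E := E) (T := T) (t := T - sr r (n + 1)) (c := c) (A := Ar m0 m1 r n)
      (B := ∑ j ∈ Finset.range n, c0 E ^ 2 * Ar m0 m1 r j ^ 2 * r j ^ 2)
      (κ := 16 * E * er r n) (g := η * er r n) (err := ∑ j ∈ Finset.range n, C5 T * r j ^ 3)
      (Cls_rec hmp hmp1 hr hr1 n) (Cls_rec hm0 hm01 hr hr1 n) (Cls_rec hm1 hm11 hr hr1 n)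
      (hm0 n) (hm01 n) (hm1 n) (hm11 n) (hm n) (hr n) (hr1 n) (by linarith) hE1
      (by nlinarith) (Finset.sum_nonneg fun _ _ => by positivity) (by positivity) hc.le hc1
      ((Ar_le hm0 hm01 hm1 hm11 n).trans hn')
      (by rw [← hA]; exact (Ar_le hm0 hm01 hm1 hm11 _).trans hn) (by linarith)
      (fun q y hq => ih hn' q y (by rw [hs] at hq; linarith)) q y hq
    rw [Finset.sum_range_succ, Finset.sum_range_succ, hA, er, ← mul_assoc (16 * E), ← mul_assoc η]
    exact this

/-- uniform quantitative midpoint convexity for the recursion -/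
lemma gap_rec (T Q h : ℝ) (hT : 0 ≤ T) (hQ : 0 < Q) : ∃ cs : ℝ, 0 < cs ∧
    ∀ (m0 m1 m r : ℕ → ℝ) (_ : ∀ n, 0 < m0 n) (_ : ∀ n, m0 n ≤ 1)
    (_ : ∀ n, 0 < m1 n) (_ : ∀ n, m1 n ≤ 1) (_ : ∀ n, m n = (m0 n + m1 n) / 2)
    (_ : ∀ n, 0 < r n) (_ : ∀ n, r n ≤ 1) (n : ℕ) (_ : sr r n ≤ T)
    (_ : Q ≤ ∑ j ∈ Finset.range n, Ar m0 m1 r j ^ 2 * r j ^ 2),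
    cs - C5 T * ∑ j ∈ Finset.range n, r j ^ 3 ≤
      (1 / 2) * Fr m0 r n h + (1 / 2) * Fr m1 r n h - Fr m r n h := by
  set E := Real.exp (C4 * T) with hE
  have hEp : 0 < E := Real.exp_pos _
  have hc0 := c0_pos hEp.le
  set P := c0 E ^ 2 * Q * Real.exp (-((16 * E * E) * (3 + h ^ 2))) with hP
  have hPp : 0 < P := by positivity
  set η := P / (2 * (E * (3 + h ^ 2))) with hη
  have hηp : 0 < η := by positivity
  obtain ⟨c, hc, hc1, hterm⟩ := terminal T η hT hηp
  refine ⟨c * (P / 2), by positivity, ?_⟩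
  intro m0 m1 m r hm0 hm01 hm1 hm11 hm hr hr1 n hn hQn
  have h1 := main_rec hm0 hm01 hm1 hm11 hm hr hr1 hE hηp hc hc1 hterm n hn 0 h
    (by simpa using hn)
  have hE1 : er r n ≤ E := by
    have := C4_ge
    exact (er_le r n).trans (Real.exp_le_exp.2 (by gcongr))
  have hD : Dg (Fr m0 r n) (Fr m1 r n) (Fr m r n) 0 h =
    (1 / 2) * Fr m0 r n h + (1 / 2) * Fr m1 r n h - Fr m r n h := by simp [Dg]
  rw [hD] at h1
  refine le_trans ?_ h1
  rw [← Finset.mul_sum]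
  have h2 : P ≤ (∑ j ∈ Finset.range n, c0 E ^ 2 * Ar m0 m1 r j ^ 2 * r j ^ 2) *
        Real.exp (-((16 * E * er r n) * (3 + h ^ 2))) := by
    have h3 : ∑ j ∈ Finset.range n, c0 E ^ 2 * Ar m0 m1 r j ^ 2 * r j ^ 2 =
      c0 E ^ 2 * ∑ j ∈ Finset.range n, Ar m0 m1 r j ^ 2 * r j ^ 2 := by
      rw [Finset.mul_sum]; refine Finset.sum_congr rfl fun j _ => by ring
    rw [h3, hP]
    have h4 : Real.exp (-((16 * E * E) * (3 + h ^ 2))) ≤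
        Real.exp (-((16 * E * er r n) * (3 + h ^ 2))) := by
      apply Real.exp_le_exp.2
      apply neg_le_neg
      gcongr
    have h5 : 0 ≤ ∑ j ∈ Finset.range n, Ar m0 m1 r j ^ 2 * r j ^ 2 := hQ.le.trans hQn
    gcongr
  have h6 : (η * er r n) * (3 + h ^ 2) ≤ P / 2 := by
    have : (η * er r n) * (3 + h ^ 2) ≤ (η * E) * (3 + h ^ 2) := by gcongr
    refine this.trans (le_of_eq ?_)
    rw [hη]; field_simp
  have h7 : c * (P / 2) ≤ c * ((0 + Ar m0 m1 r n * Fr1 m r n h) ^ 2 +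
      (∑ j ∈ Finset.range n, c0 E ^ 2 * Ar m0 m1 r j ^ 2 * r j ^ 2) *
        Real.exp (-((16 * E * er r n) * (3 + h ^ 2))) - (η * er r n) * (3 + h ^ 2)) := by
    apply mul_le_mul_of_nonneg_left _ hc.le
    have := sq_nonneg (0 + Ar m0 m1 r n * Fr1 m r n h)
    linarith
  linarith

/-! ### Facts on `ξ'` and `ζ` -/

lemma zcoef_nonneg (β : ℕ → ℝ) (p : ℕ) : 0 ≤ (p : ℝ) * ((p : ℝ) - 1) * β p ^ 2 := by
  have : (0:ℝ) ≤ (p : ℝ) * ((p : ℝ) - 1) := by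
    rcases p with _ | p
    · simp
    · push_cast; have : (0:ℝ) ≤ p := Nat.cast_nonneg p
      nlinarith
  positivity

lemma sq_le_two_pow_mul (p : ℕ) : (p : ℝ) ^ 2 ≤ 4 * 2 ^ p := by
  have h : p ^ 2 ≤ 4 * 2 ^ p := by
    induction p with
    | zero => norm_num
    | succ n ih =>
      rcases Nat.lt_or_ge n 3 with h | h
      · interval_cases n <;> norm_num
      · rw [pow_succ 2 n]; nlinarith
  exact_mod_cast h

lemma zcoef_summable {β : ℕ → ℝ} (hβ : ValidBeta β) :
    Summable fun p : ℕ => (p : ℝ) * ((p : ℝ) - 1) * β p ^ 2 := by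
  refine Summable.of_nonneg_of_le (zcoef_nonneg β) (fun p => ?_) (hβ.2.2.2.2.mul_left 4)
  have h1 := sq_le_two_pow_mul p
  have h2 : (p : ℝ) * ((p : ℝ) - 1) ≤ 4 * 2 ^ p := by
    have : (0:ℝ) ≤ p := Nat.cast_nonneg p
    nlinarith
  calc _ ≤ (4 * 2 ^ p) * β p ^ 2 := mul_le_mul_of_nonneg_right h2 (sq_nonneg _)
    _ = _ := by ring

lemma xcoef_summable {β : ℕ → ℝ} (hβ : ValidBeta β) :
    Summable fun p : ℕ => (p : ℝ) * β p ^ 2 := by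
  refine Summable.of_nonneg_of_le (fun p => by positivity) (fun p => ?_) (hβ.2.2.2.2.mul_left 4)
  have h1 := sq_le_two_pow_mul p
  have h2 : (p : ℝ) ≤ 4 * 2 ^ p := by
    have : (p:ℝ) ≤ (p:ℝ) ^ 2 := by exact_mod_cast Nat.le_self_pow (by norm_num) p
    linarith
  calc _ ≤ (4 * 2 ^ p) * β p ^ 2 := mul_le_mul_of_nonneg_right h2 (sq_nonneg _)
    _ = _ := by ring

lemma zterm_le (β : ℕ → ℝ) (p : ℕ) {s : ℝ} (hs : s ∈ Icc (0:ℝ) 1) :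
    ‖(p : ℝ) * ((p : ℝ) - 1) * β p ^ 2 * s ^ (p - 2)‖ ≤ (p : ℝ) * ((p : ℝ) - 1) * β p ^ 2 := by
  have h0 := zcoef_nonneg β p
  rw [Real.norm_of_nonneg (mul_nonneg h0 (pow_nonneg hs.1 _))]
  exact mul_le_of_le_one_right h0 (pow_le_one₀ hs.1 hs.2)

lemma zterm_summable {β : ℕ → ℝ} (hβ : ValidBeta β) {s : ℝ} (hs : s ∈ Icc (0:ℝ) 1) :
    Summable fun p : ℕ => (p : ℝ) * ((p : ℝ) - 1) * β p ^ 2 * s ^ (p - 2) :=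
  Summable.of_norm_bounded (zcoef_summable hβ) (fun p => zterm_le β p hs)

lemma xterm_summable {β : ℕ → ℝ} (hβ : ValidBeta β) {s : ℝ} (hs : s ∈ Icc (0:ℝ) 1) :
    Summable fun p : ℕ => (p : ℝ) * β p ^ 2 * s ^ (p - 1) := by
  refine Summable.of_norm_bounded (xcoef_summable hβ) (fun p => ?_)
  rw [Real.norm_of_nonneg (mul_nonneg (by positivity) (pow_nonneg hs.1 _))]
  exact mul_le_of_le_one_right (by positivity) (pow_le_one₀ hs.1 hs.2)

lemma zeta_cont {β : ℕ → ℝ} (hβ : ValidBeta β) : ContinuousOn (zetaFn β) (Icc 0 1) :=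
  continuousOn_tsum (fun p => by fun_prop) (zcoef_summable hβ) (fun p s hs => zterm_le β p hs)

lemma zeta_nonneg (β : ℕ → ℝ) {s : ℝ} (hs : 0 ≤ s) : 0 ≤ zetaFn β s :=
  tsum_nonneg fun p => mul_nonneg (zcoef_nonneg β p) (pow_nonneg hs _)

lemma zeta_pos {β : ℕ → ℝ} (hβ : ValidBeta β) {s : ℝ} (hs : 0 < s) (hs1 : s ≤ 1) :
    0 < zetaFn β s := by
  obtain ⟨p, hp, hpos⟩ := hβ.2.2.2.1
  refine (zterm_summable hβ ⟨hs.le, hs1⟩).tsum_pos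
    (fun p => mul_nonneg (zcoef_nonneg β p) (pow_nonneg hs.le _)) p ?_
  have h2 : (2:ℝ) ≤ p := by exact_mod_cast hp
  have : (0:ℝ) < (p:ℝ) - 1 := by linarith
  have : (0:ℝ) < p := by linarith
  positivity

def Zb (β : ℕ → ℝ) : ℝ := 1 + ∑' p : ℕ, (p : ℝ) * ((p : ℝ) - 1) * β p ^ 2

lemma Zb_pos (β : ℕ → ℝ) : 1 ≤ Zb β := by
  have : 0 ≤ ∑' p : ℕ, (p : ℝ) * ((p : ℝ) - 1) * β p ^ 2 := tsum_nonneg (zcoef_nonneg β)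
  unfold Zb; linarith

lemma zeta_le {β : ℕ → ℝ} (hβ : ValidBeta β) {s : ℝ} (hs : s ∈ Icc (0:ℝ) 1) :
    zetaFn β s ≤ Zb β := by
  have : zetaFn β s ≤ ∑' p : ℕ, (p : ℝ) * ((p : ℝ) - 1) * β p ^ 2 :=
    (zterm_summable hβ hs).tsum_le_tsum (fun p => (le_abs_self _).trans (zterm_le β p hs))
      (zcoef_summable hβ)
  unfold Zb; linarith

lemma zeta_intervalIntegrable {β : ℕ → ℝ} (hβ : ValidBeta β) {s t : ℝ} (hs : s ∈ Icc (0:ℝ) 1)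
    (ht : t ∈ Icc (0:ℝ) 1) : IntervalIntegrable (zetaFn β) volume s t :=
  ((zeta_cont hβ).mono (uIcc_subset_Icc hs ht)).intervalIntegrable

lemma xiD_sub {β : ℕ → ℝ} (hβ : ValidBeta β) {s t : ℝ} (hs : s ∈ Icc (0:ℝ) 1)
    (ht : t ∈ Icc (0:ℝ) 1) : xiD β t - xiD β s = ∫ u in s..t, zetaFn β u := by
  have hsub : ∀ u ∈ uIoc s t, u ∈ Icc (0:ℝ) 1 := fun u hu =>
    uIcc_subset_Icc hs ht (uIoc_subset_uIcc hu)
  have h := intervalIntegral.hasSum_integral_of_dominated_convergence (μ := volume) (a := s) (b := t)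
    (F := fun (p:ℕ) (u:ℝ) => (p : ℝ) * ((p : ℝ) - 1) * β p ^ 2 * u ^ (p - 2))
    (f := zetaFn β) (fun p _ => (p : ℝ) * ((p : ℝ) - 1) * β p ^ 2)
    (fun p => by apply Continuous.aestronglyMeasurable; fun_prop)
    (fun p => ae_of_all _ fun u hu => zterm_le β p (hsub u hu))
    (ae_of_all _ fun u hu => zcoef_summable hβ)
    (by simp)
    (ae_of_all _ fun u hu => (zterm_summable hβ (hsub u hu)).hasSum)
  have h2 := (xterm_summable hβ ht).hasSum.sub (xterm_summable hβ hs).hasSum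
  refine h2.unique (h.congr_fun ?_) 
  intro p
  rw [intervalIntegral.integral_const_mul, integral_pow]
  rcases p with _ | _ | p
  · simp
  · simp
  · have : (p:ℝ) + 1 ≠ 0 := by positivity
    simp only [Nat.add_sub_cancel, show p + 1 + 1 - 2 = p by omega]
    push_cast
    field_simp
    ring

lemma xiD_sub_pos {β : ℕ → ℝ} (hβ : ValidBeta β) {s t : ℝ} (hs : 0 ≤ s) (hst : s < t)
    (ht : t ≤ 1) : 0 < xiD β t - xiD β s := by
  have h1 : s ∈ Icc (0:ℝ) 1 := ⟨hs, by linarith⟩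
  have h2 : t ∈ Icc (0:ℝ) 1 := ⟨by linarith, ht⟩
  rw [xiD_sub hβ h1 h2]
  exact intervalIntegral.intervalIntegral_pos_of_pos_on (zeta_intervalIntegrable hβ h1 h2)
    (fun u hu => zeta_pos hβ (by linarith [hu.1]) (by linarith [hu.2])) hst

lemma xiD_sub_le {β : ℕ → ℝ} (hβ : ValidBeta β) {s t : ℝ} (hs : 0 ≤ s) (hst : s ≤ t)
    (ht : t ≤ 1) : xiD β t - xiD β s ≤ Zb β * (t - s) := by
  have h1 : s ∈ Icc (0:ℝ) 1 := ⟨hs, by linarith⟩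
  have h2 : t ∈ Icc (0:ℝ) 1 := ⟨by linarith, ht⟩
  rw [xiD_sub hβ h1 h2]
  calc ∫ u in s..t, zetaFn β u ≤ ∫ u in s..t, Zb β :=
        intervalIntegral.integral_mono_on hst (zeta_intervalIntegrable hβ h1 h2) (by simp)
          (fun u hu => zeta_le hβ ⟨by linarith [hu.1], by linarith [hu.2]⟩)
    _ = _ := by simp; ring

/-! ### distribution functions -/

lemma distF_mono {μ : Measure ℝ} (hμ : MemM μ) : Monotone (distF μ) := by
  haveI := hμ.1
  intro s t hst
  exact ENNReal.toReal_mono (measure_ne_top _ _) (measure_mono (Icc_subset_Icc_right hst))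

lemma distF_nonneg (μ : Measure ℝ) (s : ℝ) : 0 ≤ distF μ s := ENNReal.toReal_nonneg

lemma distF_le_one {μ : Measure ℝ} (hμ : MemM μ) (s : ℝ) : distF μ s ≤ 1 := by
  haveI := hμ.1
  exact measureReal_le_one

lemma distF_one {μ : Measure ℝ} (hμ : MemM μ) : distF μ 1 = 1 := by
  haveI := hμ.1
  have := (prob_compl_eq_zero_iff (μ := μ) (measurableSet_Icc (a := (0:ℝ)) (b := 1))).1 hμ.2
  simp [distF, this]

lemma distF_int {μ : Measure ℝ} (hμ : MemM μ) (s t : ℝ) :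
    IntervalIntegrable (distF μ) volume s t := (distF_mono hμ).intervalIntegrable

lemma distF_zeta_int {β : ℕ → ℝ} (hβ : ValidBeta β) {μ : Measure ℝ} (hμ : MemM μ) {s t : ℝ}
    (hs : s ∈ Icc (0:ℝ) 1) (ht : t ∈ Icc (0:ℝ) 1) :
    IntervalIntegrable (fun u => distF μ u * zetaFn β u) volume s t :=
  (distF_int hμ s t).mul_continuousOn ((zeta_cont hβ).mono (uIcc_subset_Icc hs ht))

lemma eq_of_distF {μ ν : Measure ℝ} (hμ : MemM μ) (hν : MemM ν)
    (h : ∀ s ∈ Ico (0:ℝ) 1, distF μ s = distF ν s) : μ = ν := by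
  haveI := hμ.1
  haveI := hν.1
  have key : ∀ {ρ : Measure ℝ}, MemM ρ → ∀ s, ρ (Iic s) = ρ (Icc 0 s) := by
    intro ρ hρ s
    refine le_antisymm ?_ (measure_mono Icc_subset_Iic_self)
    calc ρ (Iic s) ≤ ρ (Icc 0 s ∪ (Icc 0 1)ᶜ) := by
          apply measure_mono; intro x hx
          by_cases h0 : 0 ≤ x
          · exact Or.inl ⟨h0, hx⟩
          · exact Or.inr (fun h => h0 h.1)
      _ ≤ ρ (Icc 0 s) + ρ (Icc 0 1)ᶜ := measure_union_le _ _
      _ = _ := by rw [hρ.2, add_zero]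
  refine Measure.ext_of_Iic _ _ fun s => ?_
  rw [key hμ, key hν]
  rw [← ENNReal.toReal_eq_toReal_iff' (measure_ne_top _ _) (measure_ne_top _ _)]
  change distF μ s = distF ν s
  rcases lt_or_ge s 0 with h0 | h0
  · simp [distF, h0]
  rcases lt_or_ge s 1 with h1 | h1
  · exact h s ⟨h0, h1⟩
  · have : ∀ {ρ : Measure ℝ}, MemM ρ → distF ρ s = 1 := fun hρ =>
      le_antisymm (distF_le_one hρ s) ((distF_one hρ).symm.le.trans (distF_mono hρ h1))
    rw [this hμ, this hν]

lemma distF_rightCont {μ : Measure ℝ} (hμ : MemM μ) {s : ℝ} (hs : 0 ≤ s) :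
    Tendsto (distF μ) (nhdsWithin s (Ioi s)) (nhds (distF μ s)) := by
  haveI := hμ.1
  have h := tendsto_measure_biInter_gt (μ := μ) (s := fun r => Icc (0:ℝ) r) (a := s)
    (fun r _ => measurableSet_Icc.nullMeasurableSet) (fun i j _ hij => Icc_subset_Icc_right hij)
    ⟨s + 1, by simp, measure_ne_top _ _⟩
  have e : (⋂ r > s, Icc (0:ℝ) r) = Icc 0 s := by
    ext x
    simp only [mem_iInter, mem_Icc]
    constructor
    · intro hx
      exact ⟨(hx (s+1) (by simp)).1, le_of_forall_gt_imp_ge_of_dense fun r hr => (hx r hr).2⟩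
    · intro hx r hr
      exact ⟨hx.1, hx.2.trans hr.le⟩
  rw [e] at h
  exact (ENNReal.tendsto_toReal (measure_ne_top _ _)).comp h

/-! ### Discretised measures -/

def wts (M : ℕ → ℝ) : ℕ → ℝ
  | 0 => M 0
  | k + 1 => M (k + 1) - M k

lemma wts_sum (M : ℕ → ℝ) (n : ℕ) : ∑ k ∈ Finset.range (n + 1), wts M k = M n := by
  induction n with
  | zero => simp [wts]
  | succ n ih => rw [Finset.sum_range_succ, ih]; simp [wts]

lemma wts_pos {M : ℕ → ℝ} (h0 : 0 < M 0) (hM : StrictMono M) (k : ℕ) : 0 < wts M k := by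
  rcases k with _ | k
  · exact h0
  · simpa [wts] using hM (Nat.lt_succ_self k)

def nuM (N : ℕ) (M : ℕ → ℝ) : Measure ℝ :=
  ∑ k ∈ Finset.range (N + 1), ENNReal.ofReal (wts M k) • Measure.dirac ((k:ℝ) / N)

lemma nuM_apply (N : ℕ) (M : ℕ → ℝ) {A : Set ℝ} (hA : MeasurableSet A) :
    nuM N M A = ∑ k ∈ Finset.range (N + 1),
      ENNReal.ofReal (wts M k) * A.indicator 1 ((k:ℝ) / N) := by
  simp [nuM, hA, Measure.dirac_apply']

lemma nuM_null (N : ℕ) (M : ℕ → ℝ) {A : Set ℝ} (hA : MeasurableSet A)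
    (h : ∀ k ≤ N, (k:ℝ) / N ∉ A) : nuM N M A = 0 := by
  rw [nuM_apply N M hA]
  refine Finset.sum_eq_zero fun k hk => ?_
  rw [Set.indicator_of_notMem (h k (Nat.lt_succ_iff.1 (Finset.mem_range.1 hk))), mul_zero]

lemma nuM_memM {N : ℕ} (hN : 0 < N) {M : ℕ → ℝ} (h0 : 0 < M 0) (hM : StrictMono M)
    (h1 : M N = 1) : MemM (nuM N M) := by
  have hN' : (0:ℝ) < N := by exact_mod_cast hN
  refine ⟨⟨?_⟩, nuM_null N M measurableSet_Icc.compl fun k hk => ?_⟩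
  · rw [nuM_apply N M MeasurableSet.univ]
    simp only [indicator_univ, Pi.one_apply, mul_one]
    rw [← ENNReal.ofReal_sum_of_nonneg (fun k _ => (wts_pos h0 hM k).le), wts_sum, h1]
    simp
  · simp only [mem_compl_iff, not_not]
    have : (k:ℝ) ≤ N := by exact_mod_cast hk
    exact ⟨by positivity, (div_le_one hN').2 this⟩

lemma nuM_finSupp (N : ℕ) (M : ℕ → ℝ) : FinSupp (nuM N M) := by
  refine ⟨(Finset.range (N + 1)).image fun k : ℕ => (k:ℝ) / N, nuM_null N M ?_ fun k hk => ?_⟩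
  · exact (Finset.measurableSet _).compl
  · simp only [mem_compl_iff, not_not, Finset.coe_image, mem_image, Finset.mem_coe,
      Finset.mem_range]
    exact ⟨k, by omega, rfl⟩

lemma nuM_distF {N : ℕ} (hN : 0 < N) {M : ℕ → ℝ} (h0 : 0 < M 0) (hM : StrictMono M)
    {j : ℕ} (hj : j < N) {s : ℝ} (hs : (j:ℝ) / N ≤ s) (hs' : s < ((j:ℝ) + 1) / N) :
    distF (nuM N M) s = M j := by
  have hN' : (0:ℝ) < N := by exact_mod_cast hN
  have key : ∀ k : ℕ, (k:ℝ) / N ∈ Icc 0 s ↔ k < j + 1 := by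
    intro k
    constructor
    · intro hk
      have := hk.2.trans_lt hs'
      rw [div_lt_div_iff_of_pos_right hN'] at this
      exact_mod_cast this
    · intro hk
      refine ⟨by positivity, le_trans ?_ hs⟩
      have : (k:ℝ) ≤ j := by exact_mod_cast Nat.lt_succ_iff.1 hk
      gcongr
  unfold distF
  rw [nuM_apply N M measurableSet_Icc]
  have : ∑ k ∈ Finset.range (N + 1),
      ENNReal.ofReal (wts M k) * (Icc 0 s).indicator 1 ((k:ℝ) / N)
      = ∑ k ∈ Finset.range (j + 1), ENNReal.ofReal (wts M k) := by
    symm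
    rw [← Finset.sum_subset (Finset.range_mono (show j + 1 ≤ N + 1 by omega))]
    · refine Finset.sum_congr rfl fun k hk => ?_
      rw [Set.indicator_of_mem ((key k).2 (Finset.mem_range.1 hk))]; simp
    · intro k _ hk
      rw [Set.indicator_of_notMem, mul_zero]
      rw [key]; simpa using hk
  rw [this, ← ENNReal.ofReal_sum_of_nonneg (fun k _ => (wts_pos h0 hM k).le), wts_sum]
  exact ENNReal.toReal_ofReal (h0.le.trans (hM.monotone (Nat.zero_le j)))

lemma nuM_nextPt {N : ℕ} (hN : 0 < N) {M : ℕ → ℝ} (h0 : 0 < M 0) (hM : StrictMono M)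
    {j : ℕ} (hj : j < N) : nextPt (nuM N M) ((j:ℝ) / N) = ((j + 1 : ℕ):ℝ) / N := by
  have hN' : (0:ℝ) < N := by exact_mod_cast hN
  have hle : ((j + 1 : ℕ):ℝ) / N ≤ 1 := (div_le_one hN').2 (by exact_mod_cast hj)
  unfold nextPt
  apply IsLeast.csInf_eq
  constructor
  · left
    refine ⟨?_, hle, ?_⟩
    · gcongr; simp
    · rw [nuM_apply N M (measurableSet_singleton _)]
      intro h
      rw [Finset.sum_eq_zero_iff] at h
      have := h (j + 1) (Finset.mem_range.2 (by omega))
      rw [Set.indicator_of_mem (by simp)] at this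
      simp only [Pi.one_apply, mul_one, ENNReal.ofReal_eq_zero] at this
      exact absurd (wts_pos h0 hM (j + 1)) (not_lt.2 this)
  · rintro q (⟨hq1, hq2, hq3⟩ | hq)
    · by_contra hlt
      rw [not_le] at hlt
      apply hq3
      refine nuM_null N M (measurableSet_singleton _) fun k hk hkq => ?_
      rw [mem_singleton_iff] at hkq
      rw [← hkq, div_lt_div_iff_of_pos_right hN'] at hq1 hlt
      have a : j < k := by exact_mod_cast hq1
      have b : k < j + 1 := by exact_mod_cast hlt
      omega
    · rw [mem_singleton_iff] at hq; rw [hq]; exact hle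

/-- levels of the `N`-th discretisation of `μ` -/
def lev (μ : Measure ℝ) (N : ℕ) (k : ℕ) : ℝ :=
  (1 - 1 / (N:ℝ)) * distF μ ((k:ℝ) / N) + (1 / (N:ℝ)) * (((k:ℝ) + 1) / ((N:ℝ) + 1))

lemma lev_strictMono {μ : Measure ℝ} (hμ : MemM μ) {N : ℕ} (hN : 0 < N) :
    StrictMono (lev μ N) := by
  have hN' : (1:ℝ) ≤ N := by exact_mod_cast hN
  intro a b hab
  have hab' : (a:ℝ) < b := by exact_mod_cast hab
  have h1 : distF μ ((a:ℝ) / N) ≤ distF μ ((b:ℝ) / N) := distF_mono hμ (by gcongr)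
  have h2 : 0 ≤ 1 - 1 / (N:ℝ) := by
    rw [sub_nonneg]; exact (div_le_one (by linarith)).2 hN'
  have h3 : ((a:ℝ) + 1) / ((N:ℝ) + 1) < ((b:ℝ) + 1) / ((N:ℝ) + 1) := by gcongr
  have h4 : (1 / (N:ℝ)) * (((a:ℝ) + 1) / ((N:ℝ) + 1)) < (1 / (N:ℝ)) * (((b:ℝ) + 1) / ((N:ℝ) + 1)) :=
    mul_lt_mul_of_pos_left h3 (by positivity)
  have h5 := mul_le_mul_of_nonneg_left h1 h2
  unfold lev; linarith

lemma lev_zero_pos (μ : Measure ℝ) {N : ℕ} (hN : 0 < N) : 0 < lev μ N 0 := by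
  have hN' : (1:ℝ) ≤ N := by exact_mod_cast hN
  have h2 : 0 ≤ 1 - 1 / (N:ℝ) := by
    rw [sub_nonneg]; exact (div_le_one (by linarith)).2 hN'
  have h3 := mul_nonneg h2 (distF_nonneg μ (((0:ℕ):ℝ) / N))
  have h4 : 0 < (1 / (N:ℝ)) * ((((0:ℕ):ℝ) + 1) / ((N:ℝ) + 1)) := by positivity
  unfold lev; linarith

lemma lev_top {μ : Measure ℝ} (hμ : MemM μ) {N : ℕ} (hN : 0 < N) : lev μ N N = 1 := by
  have hN' : (0:ℝ) < N := by exact_mod_cast hN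
  unfold lev
  rw [div_self hN'.ne', distF_one hμ]
  field_simp
  ring

lemma lev_close {μ : Measure ℝ} (hμ : MemM μ) {N : ℕ} (hN : 0 < N) {k : ℕ} (hk : k ≤ N) :
    |lev μ N k - distF μ ((k:ℝ) / N)| ≤ 1 / N := by
  have hN' : (0:ℝ) < N := by exact_mod_cast hN
  have hk' : (k:ℝ) ≤ N := by exact_mod_cast hk
  have e : lev μ N k - distF μ ((k:ℝ) / N) =
      (1 / (N:ℝ)) * ((((k:ℝ) + 1) / ((N:ℝ) + 1)) - distF μ ((k:ℝ) / N)) := by unfold lev; ring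
  rw [e, abs_mul, abs_of_pos (by positivity)]
  refine mul_le_of_le_one_right (by positivity) ?_
  have h1 := distF_nonneg μ ((k:ℝ) / N)
  have h2 := distF_le_one hμ ((k:ℝ) / N)
  have h3 : 0 ≤ ((k:ℝ) + 1) / ((N:ℝ) + 1) := by positivity
  have h4 : ((k:ℝ) + 1) / ((N:ℝ) + 1) ≤ 1 := (div_le_one (by positivity)).2 (by linarith)
  rw [abs_le]; constructor <;> linarith

def nuD (μ : Measure ℝ) (N : ℕ) : Measure ℝ := nuM N (lev μ N)

lemma nuD_memM {μ : Measure ℝ} (hμ : MemM μ) {N : ℕ} (hN : 0 < N) : MemM (nuD μ N) :=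
  nuM_memM hN (lev_zero_pos μ hN) (lev_strictMono hμ hN) (lev_top hμ hN)

lemma nuD_distF {μ : Measure ℝ} (hμ : MemM μ) {N : ℕ} (hN : 0 < N)
    {j : ℕ} (hj : j < N) {s : ℝ} (hs : (j:ℝ) / N ≤ s) (hs' : s < ((j:ℝ) + 1) / N) :
    distF (nuD μ N) s = lev μ N j :=
  nuM_distF hN (lev_zero_pos μ hN) (lev_strictMono hμ hN) hj hs hs'

lemma dist_int {μ ν : Measure ℝ} (hμ : MemM μ) (hν : MemM ν) (a b : ℝ) :
    IntervalIntegrable (fun s => |distF μ s - distF ν s|) volume a b :=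
  ((distF_int hμ a b).sub (distF_int hν a b)).abs

lemma unit_split (f : ℝ → ℝ) {N : ℕ} (hN : 0 < N)
    (hf : IntervalIntegrable f volume 0 1) :
    ∫ s in (0:ℝ)..1, f s =
      ∑ k ∈ Finset.range N, ∫ s in ((k:ℝ) / N)..(((k:ℝ) + 1) / N), f s := by
  have hN' : (0:ℝ) < N := by exact_mod_cast hN
  have h := intervalIntegral.sum_integral_adjacent_intervals (μ := volume) (f := f)
    (a := fun k : ℕ => (k:ℝ) / N) (n := N) (fun k hk => by
      apply hf.mono_set
      have hk' : (k:ℝ) + 1 ≤ N := by exact_mod_cast hk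
      rw [uIcc_of_le (by gcongr; simp), uIcc_of_le zero_le_one]
      apply Icc_subset_Icc (by positivity)
      push_cast
      exact (div_le_one hN').2 hk')
  rw [div_self hN'.ne'] at h
  simp only [Nat.cast_zero, zero_div] at h
  rw [← h]
  simp

lemma grid_mem {N : ℕ} (hN : 0 < N) {k : ℕ} (hk : k ≤ N) : (k:ℝ) / N ∈ Icc (0:ℝ) 1 := by
  have hN' : (0:ℝ) < N := by exact_mod_cast hN
  exact ⟨by positivity, (div_le_one hN').2 (by exact_mod_cast hk)⟩

lemma grid_mem' {N : ℕ} (hN : 0 < N) {k : ℕ} (hk : k < N) : ((k:ℝ) + 1) / N ∈ Icc (0:ℝ) 1 := by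
  have := grid_mem hN (Nat.succ_le_of_lt hk)
  push_cast at this; exact this

lemma dM_nuD {μ : Measure ℝ} (hμ : MemM μ) {N : ℕ} (hN : 0 < N) : dM μ (nuD μ N) ≤ 2 / N := by
  have hN' : (0:ℝ) < N := by exact_mod_cast hN
  unfold dM
  have hIgr := dist_int hμ (nuD_memM hμ hN)
  rw [unit_split _ hN (hIgr 0 1)]
  have h1 : ∀ k ∈ Finset.range N, ∫ s in ((k:ℝ) / N)..(((k:ℝ) + 1) / N),
      |distF μ s - distF (nuD μ N) s| ≤
      (1 / (N:ℝ)) * ((distF μ (((k + 1 : ℕ):ℝ) / N) - distF μ ((k:ℝ) / N)) + 1 / N) := by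
    intro k hk
    have hk := Finset.mem_range.1 hk
    have hle : (k:ℝ) / N ≤ ((k:ℝ) + 1) / N := by gcongr; simp
    calc _ ≤ ∫ s in ((k:ℝ) / N)..(((k:ℝ) + 1) / N),
          ((distF μ (((k + 1 : ℕ):ℝ) / N) - distF μ ((k:ℝ) / N)) + 1 / N) := by
          refine intervalIntegral.integral_mono_on_of_le_Ioo hle (hIgr _ _) (by simp) fun s hs => ?_
          rw [nuD_distF hμ hN hk hs.1.le hs.2]
          have a := distF_mono hμ hs.1.le
          have b := distF_mono hμ hs.2.le
          have c := abs_le.1 (lev_close hμ hN hk.le)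
          push_cast
          rw [abs_le]; constructor <;> linarith [c.1, c.2]
      _ = _ := by
          rw [intervalIntegral.integral_const, smul_eq_mul]; congr 1; field_simp; ring
  refine (Finset.sum_le_sum h1).trans ?_
  rw [← Finset.mul_sum, Finset.sum_add_distrib, Finset.sum_range_sub (fun k : ℕ => distF μ ((k:ℝ) / N))]
  simp only [Finset.sum_const, Finset.card_range, nsmul_eq_mul]
  have a := distF_le_one hμ ((N:ℝ) / N)
  have b := distF_nonneg μ (((0:ℕ):ℝ) / N)
  have c : (N:ℝ) * (1 / N) = 1 := by field_simp
  rw [c]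
  calc _ ≤ 1 / (N:ℝ) * 2 := mul_le_mul_of_nonneg_left (by linarith) (by positivity)
    _ = _ := by ring

/-! ### The recursion on the grid -/

def mD (μ : Measure ℝ) (N : ℕ) (n : ℕ) : ℝ := lev μ N (N - 1 - n)

def rD (β : ℕ → ℝ) (N : ℕ) (n : ℕ) : ℝ :=
  Real.sqrt (xiD β ((((N - 1 - n) + 1 : ℕ):ℝ) / N) - xiD β (((N - 1 - n : ℕ):ℝ) / N))

lemma mD_pos {μ : Measure ℝ} (hμ : MemM μ) {N : ℕ} (hN : 0 < N) (n : ℕ) : 0 < mD μ N n :=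
  (lev_zero_pos μ hN).trans_le ((lev_strictMono hμ hN).monotone (Nat.zero_le _))

lemma mD_le {μ : Measure ℝ} (hμ : MemM μ) {N : ℕ} (hN : 0 < N) (n : ℕ) : mD μ N n ≤ 1 := by
  rw [← lev_top hμ hN]
  exact (lev_strictMono hμ hN).monotone (by omega)

lemma tau_pos {β : ℕ → ℝ} (hβ : ValidBeta β) {N : ℕ} (hN : 0 < N) {k : ℕ} (hk : k < N) :
    0 < xiD β (((k + 1 : ℕ):ℝ) / N) - xiD β ((k:ℝ) / N) :=
  xiD_sub_pos hβ (grid_mem hN hk.le).1 (by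
    have hN' : (0:ℝ) < N := by exact_mod_cast hN
    gcongr; simp) (grid_mem hN hk).2

lemma tau_le {β : ℕ → ℝ} (hβ : ValidBeta β) {N : ℕ} (hN : 0 < N) {k : ℕ} (hk : k < N) :
    xiD β (((k + 1 : ℕ):ℝ) / N) - xiD β ((k:ℝ) / N) ≤ Zb β / N := by
  have hN' : (0:ℝ) < N := by exact_mod_cast hN
  refine (xiD_sub_le hβ (grid_mem hN hk.le).1 (by gcongr; simp) (grid_mem hN hk).2).trans (le_of_eq ?_)
  push_cast; field_simp; ring

lemma rD_pos {β : ℕ → ℝ} (hβ : ValidBeta β) {N : ℕ} (hN : 0 < N) (n : ℕ) : 0 < rD β N n :=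
  Real.sqrt_pos.2 (tau_pos hβ hN (by omega))

lemma rD_sq {β : ℕ → ℝ} (hβ : ValidBeta β) {N : ℕ} (hN : 0 < N) (n : ℕ) :
    rD β N n ^ 2 = xiD β ((((N - 1 - n) + 1 : ℕ):ℝ) / N) - xiD β (((N - 1 - n : ℕ):ℝ) / N) :=
  Real.sq_sqrt (tau_pos hβ hN (by omega)).le

lemma rD_sq_le {β : ℕ → ℝ} (hβ : ValidBeta β) {N : ℕ} (hN : 0 < N) (n : ℕ) :
    rD β N n ^ 2 ≤ Zb β / N := by
  rw [rD_sq hβ hN]; exact tau_le hβ hN (by omega)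

lemma Fr_eq {β : ℕ → ℝ} {Φ : Measure ℝ → ℝ → ℝ → ℝ} (hΦ : IsParisiFamily β Φ)
    {μ : Measure ℝ} (hμ : MemM μ) {N : ℕ} (hN : 0 < N) (n : ℕ) (hn : n ≤ N) (x : ℝ) :
    Φ (nuD μ N) (((N - n : ℕ):ℝ) / N) x = Fr (mD μ N) (rD β N) n x := by
  have hN' : (0:ℝ) < N := by exact_mod_cast hN
  have hsol := hΦ.1 _ (nuD_memM hμ hN) (nuM_finSupp N (lev μ N))
  induction n generalizing x with
  | zero => rw [Nat.sub_zero, div_self hN'.ne']; exact hsol.1 x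
  | succ n ih =>
    have ih := fun x => ih (by omega) x
    set k := N - (n + 1) with hk
    have hkN : k < N := by omega
    have e1 : N - n = k + 1 := by omega
    have e2 : N - 1 - n = k := by omega
    rw [e1] at ih
    have hlt : (k:ℝ) / N < 1 := (div_lt_one hN').2 (by exact_mod_cast hkN)
    rw [hsol.2 _ ⟨(grid_mem hN hkN.le).1, hlt⟩ x]
    have hd : distF (nuD μ N) ((k:ℝ) / N) = lev μ N k :=
      nuD_distF hμ hN hkN le_rfl (by gcongr; simp)
    have hnx : nextPt (nuD μ N) ((k:ℝ) / N) = ((k + 1 : ℕ):ℝ) / N :=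
      nuM_nextPt hN (lev_zero_pos μ hN) (lev_strictMono hμ hN) hkN
    rw [hd, hnx]
    have hm : lev μ N k ≠ 0 := by
      have := mD_pos hμ hN n
      rw [mD, e2] at this; exact this.ne'
    rw [gStep, if_neg hm]
    simp only [Fr, Pst, mD, rD, e2]
    simp only [ih]

lemma Fr_top {β : ℕ → ℝ} {Φ : Measure ℝ → ℝ → ℝ → ℝ} (hΦ : IsParisiFamily β Φ)
    {μ : Measure ℝ} (hμ : MemM μ) {N : ℕ} (hN : 0 < N) (x : ℝ) :
    Φ (nuD μ N) 0 x = Fr (mD μ N) (rD β N) N x := by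
  have := Fr_eq hΦ hμ hN N le_rfl x
  simpa using this

lemma Phi_lim {β : ℕ → ℝ} {Φ : Measure ℝ → ℝ → ℝ → ℝ} (hΦ : IsParisiFamily β Φ)
    {μ : Measure ℝ} (hμ : MemM μ) (x : ℝ) :
    Tendsto (fun N : ℕ => Fr (mD μ N) (rD β N) N x) atTop (nhds (Φ μ 0 x)) := by
  rw [Metric.tendsto_atTop]
  intro ε hε
  obtain ⟨δ, hδ, H⟩ := hΦ.2 μ hμ ε hε
  obtain ⟨n, hn⟩ := exists_nat_gt (2 / δ)
  refine ⟨n + 1, fun N hN => ?_⟩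
  have hN0 : 0 < N := by omega
  have hN' : (0:ℝ) < N := by exact_mod_cast hN0
  rw [← Fr_top hΦ hμ hN0, Real.dist_eq, abs_sub_comm]
  refine H _ (nuD_memM hμ hN0) ((dM_nuD hμ hN0).trans_lt ?_) 0 (by simp) x
  have : (n:ℝ) < N := by exact_mod_cast (show n < N by omega)
  rw [div_lt_iff₀ hN']
  rw [div_lt_iff₀ hδ] at hn
  nlinarith

/-! ### Strict midpoint convexity -/

def mid (μ0 μ1 : Measure ℝ) : Measure ℝ := (2:ENNReal)⁻¹ • μ0 + (2:ENNReal)⁻¹ • μ1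

lemma mid_memM {μ0 μ1 : Measure ℝ} (h0 : MemM μ0) (h1 : MemM μ1) : MemM (mid μ0 μ1) := by
  have := h0.1
  have := h1.1
  refine ⟨⟨?_⟩, ?_⟩
  · simp [mid, ENNReal.inv_two_add_inv_two]
  · simp [mid, h0.2, h1.2]

lemma mid_distF {μ0 μ1 : Measure ℝ} (h0 : MemM μ0) (h1 : MemM μ1) (s : ℝ) :
    distF (mid μ0 μ1) s = (distF μ0 s + distF μ1 s) / 2 := by
  have := h0.1
  have := h1.1
  simp only [distF, mid, Measure.add_apply, Measure.smul_apply, smul_eq_mul]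
  rw [ENNReal.toReal_add (by finiteness) (by finiteness), ENNReal.toReal_mul, ENNReal.toReal_mul]
  simp
  ring

lemma mid_mD {μ0 μ1 : Measure ℝ} (h0 : MemM μ0) (h1 : MemM μ1) (N n : ℕ) :
    mD (mid μ0 μ1) N n = (mD μ0 N n + mD μ1 N n) / 2 := by
  simp only [mD, lev, mid_distF h0 h1]; ring

def Af (β : ℕ → ℝ) (μ0 μ1 : Measure ℝ) (s : ℝ) : ℝ :=
  ∫ u in s..1, (distF μ0 u - distF μ1 u) * zetaFn β u

lemma diff_int {β : ℕ → ℝ} (hβ : ValidBeta β) {μ0 μ1 : Measure ℝ} (h0 : MemM μ0) (h1 : MemM μ1)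
    {s t : ℝ} (hs : s ∈ Icc (0:ℝ) 1) (ht : t ∈ Icc (0:ℝ) 1) :
    IntervalIntegrable (fun u => (distF μ0 u - distF μ1 u) * zetaFn β u) volume s t :=
  ((distF_int h0 s t).sub (distF_int h1 s t)).mul_continuousOn
    ((zeta_cont hβ).mono (uIcc_subset_Icc hs ht))

lemma diff_bound {β : ℕ → ℝ} (hβ : ValidBeta β) {μ0 μ1 : Measure ℝ} (h0 : MemM μ0) (h1 : MemM μ1)
    {u : ℝ} (hu : u ∈ Icc (0:ℝ) 1) : |(distF μ0 u - distF μ1 u) * zetaFn β u| ≤ Zb β := by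
  rw [abs_mul, abs_of_nonneg (zeta_nonneg β hu.1)]
  have a : |distF μ0 u - distF μ1 u| ≤ 1 := by
    rw [abs_le]
    constructor <;> linarith [distF_nonneg μ0 u, distF_nonneg μ1 u, distF_le_one h0 u, distF_le_one h1 u]
  calc _ ≤ 1 * zetaFn β u := mul_le_mul_of_nonneg_right a (zeta_nonneg β hu.1)
    _ ≤ _ := by rw [one_mul]; exact zeta_le hβ hu

lemma Af_sub {β : ℕ → ℝ} (hβ : ValidBeta β) {μ0 μ1 : Measure ℝ} (h0 : MemM μ0) (h1 : MemM μ1)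
    {s t : ℝ} (hs : s ∈ Icc (0:ℝ) 1) (ht : t ∈ Icc (0:ℝ) 1) :
    Af β μ0 μ1 s = (∫ u in s..t, (distF μ0 u - distF μ1 u) * zetaFn β u) + Af β μ0 μ1 t :=
  (intervalIntegral.integral_add_adjacent_intervals (diff_int hβ h0 h1 hs ht)
    (diff_int hβ h0 h1 ht (by simp))).symm

lemma Af_lip {β : ℕ → ℝ} (hβ : ValidBeta β) {μ0 μ1 : Measure ℝ} (h0 : MemM μ0) (h1 : MemM μ1)
    {s t : ℝ} (hs : s ∈ Icc (0:ℝ) 1) (ht : t ∈ Icc (0:ℝ) 1) :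
    |Af β μ0 μ1 s - Af β μ0 μ1 t| ≤ Zb β * |t - s| := by
  rw [Af_sub hβ h0 h1 hs ht, add_sub_cancel_right]
  rw [← Real.norm_eq_abs]
  refine intervalIntegral.norm_integral_le_of_norm_le_const fun u hu => ?_
  rw [Real.norm_eq_abs]
  exact diff_bound hβ h0 h1 (uIcc_subset_Icc hs ht (uIoc_subset_uIcc hu))

lemma Af_cont {β : ℕ → ℝ} (hβ : ValidBeta β) {μ0 μ1 : Measure ℝ} (h0 : MemM μ0) (h1 : MemM μ1) :
    ContinuousOn (Af β μ0 μ1) (Icc 0 1) := by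
  have : LipschitzOnWith (Zb β).toNNReal (Af β μ0 μ1) (Icc 0 1) := by
    refine LipschitzOnWith.of_dist_le_mul fun s hs t ht => ?_
    rw [Real.coe_toNNReal _ (by linarith [Zb_pos β]), Real.dist_eq, Real.dist_eq, abs_sub_comm s t]
    exact Af_lip hβ h0 h1 hs ht
  exact this.continuousOn

lemma Af_nu {β : ℕ → ℝ} (hβ : ValidBeta β) {μ0 μ1 : Measure ℝ} (h0 : MemM μ0) (h1 : MemM μ1)
    {N : ℕ} (hN : 0 < N) (n : ℕ) (hn : n ≤ N) :
    Ar (mD μ0 N) (mD μ1 N) (rD β N) n = Af β (nuD μ0 N) (nuD μ1 N) (((N - n : ℕ):ℝ) / N) := by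
  have hN' : (0:ℝ) < N := by exact_mod_cast hN
  induction n with
  | zero => simp [Ar, Af, hN'.ne']
  | succ n ih =>
    have ih := ih (by omega)
    rw [Ar, Finset.sum_range_succ, ← Ar, ih]
    set k := N - (n + 1) with hk
    have hkN : k < N := by omega
    have e1 : N - n = k + 1 := by omega
    have e2 : N - 1 - n = k := by omega
    rw [e1]
    rw [Af_sub hβ (nuD_memM h0 hN) (nuD_memM h1 hN) (grid_mem hN hkN.le) (grid_mem hN hkN), add_comm]
    congr 1
    rw [rD_sq hβ hN, e2, mD, mD, e2, xiD_sub hβ (grid_mem hN hkN.le) (grid_mem hN hkN),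
      ← intervalIntegral.integral_const_mul]
    refine intervalIntegral.integral_congr_Ioo_of_le (by gcongr; simp) fun u hu => ?_
    have hu2 := hu.2
    push_cast at hu2
    simp only [nuD_distF h0 hN hkN hu.1.le hu2, nuD_distF h1 hN hkN hu.1.le hu2]

lemma Af_dist {β : ℕ → ℝ} (hβ : ValidBeta β) {μ0 μ1 ν0 ν1 : Measure ℝ} (h0 : MemM μ0)
    (h1 : MemM μ1) (k0 : MemM ν0) (k1 : MemM ν1) {s : ℝ} (hs : s ∈ Icc (0:ℝ) 1) :
    |Af β μ0 μ1 s - Af β ν0 ν1 s| ≤ Zb β * (dM μ0 ν0 + dM μ1 ν1) := by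
  have one : (1:ℝ) ∈ Icc (0:ℝ) 1 := by simp
  unfold Af
  rw [← intervalIntegral.integral_sub (diff_int hβ h0 h1 hs one) (diff_int hβ k0 k1 hs one)]
  have hg : ∀ a b : ℝ, IntervalIntegrable (fun u => Zb β * (|distF μ0 u - distF ν0 u| +
      |distF μ1 u - distF ν1 u|)) volume a b := fun a b =>
    ((dist_int h0 k0 a b).add (dist_int h1 k1 a b)).const_mul _
  calc _ ≤ ∫ u in s..1, Zb β * (|distF μ0 u - distF ν0 u| + |distF μ1 u - distF ν1 u|) := by
        rw [← Real.norm_eq_abs]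
        refine intervalIntegral.norm_integral_le_of_norm_le hs.2 (ae_of_all _ fun u hu => ?_) (hg _ _)
        have hu' : u ∈ Icc (0:ℝ) 1 := ⟨hs.1.trans hu.1.le, hu.2⟩
        have e : (distF μ0 u - distF μ1 u) * zetaFn β u - (distF ν0 u - distF ν1 u) * zetaFn β u
          = zetaFn β u * ((distF μ0 u - distF ν0 u) - (distF μ1 u - distF ν1 u)) := by ring
        rw [e, Real.norm_eq_abs, abs_mul, abs_of_nonneg (zeta_nonneg β hu'.1)]
        exact mul_le_mul (zeta_le hβ hu') (abs_sub _ _) (abs_nonneg _) (by linarith [Zb_pos β])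
    _ ≤ ∫ u in (0:ℝ)..1, Zb β * (|distF μ0 u - distF ν0 u| + |distF μ1 u - distF ν1 u|) := by
        refine intervalIntegral.integral_mono_interval hs.1 hs.2 le_rfl (ae_of_all _ fun u => ?_) (hg _ _)
        have := Zb_pos β
        have : 0 ≤ Zb β := by linarith
        simp only [Pi.zero_apply]; positivity
    _ = _ := by
        rw [intervalIntegral.integral_const_mul,
          intervalIntegral.integral_add (dist_int h0 k0 0 1) (dist_int h1 k1 0 1)]
        rfl

lemma QI_pos {β : ℕ → ℝ} (hβ : ValidBeta β) {μ0 μ1 : Measure ℝ} (h0 : MemM μ0) (h1 : MemM μ1)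
    (hne : μ0 ≠ μ1) : 0 < ∫ s in (0:ℝ)..1, Af β μ0 μ1 s ^ 2 * zetaFn β s := by
  refine intervalIntegral.integral_pos zero_lt_one (((Af_cont hβ h0 h1).pow 2).mul (zeta_cont hβ))
    (fun s hs => mul_nonneg (sq_nonneg _) (zeta_nonneg β hs.1.le)) ?_
  by_contra hcon
  have hA : ∀ c, 0 < c → c ≤ 1 → Af β μ0 μ1 c = 0 := by
    intro c hc hc1
    by_contra hA
    exact hcon ⟨c, ⟨hc.le, hc1⟩, mul_pos (by positivity) (zeta_pos hβ hc hc1)⟩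
  have key : ∀ {ρ0 ρ1 : Measure ℝ}, MemM ρ0 → MemM ρ1 →
      (∀ c, 0 < c → c ≤ 1 → Af β ρ0 ρ1 c = 0) → ∀ s ∈ Ico (0:ℝ) 1, distF ρ0 s ≤ distF ρ1 s := by
    intro ρ0 ρ1 k0 k1 hA s hs
    by_contra hlt
    rw [not_le] at hlt
    have t1 := (distF_rightCont k0 hs.1).sub (distF_rightCont k1 hs.1)
    have t2 : ∀ᶠ u in nhdsWithin s (Ioi s), 0 < distF ρ0 u - distF ρ1 u :=
      t1.eventually (lt_mem_nhds (by linarith))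
    obtain ⟨b, hb, hb2⟩ := (mem_nhdsGT_iff_exists_Ioo_subset).1 t2
    rw [mem_Ioi] at hb
    set d := min b 1 with hd
    have hsd : s < d := lt_min hb hs.2
    have hdb : d ≤ b := min_le_left _ _
    have hd1 : d ≤ 1 := min_le_right _ _
    set a := (s + d) / 2 with ha
    have m1 : a ∈ Icc (0:ℝ) 1 := ⟨by linarith [hs.1], by linarith⟩
    have m2 : d ∈ Icc (0:ℝ) 1 := ⟨by linarith [hs.1], by linarith⟩
    have e := Af_sub hβ k0 k1 m1 m2
    rw [hA a (by linarith [hs.1]) m1.2, hA d (by linarith [hs.1]) m2.2, add_zero] at e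
    have p := intervalIntegral.intervalIntegral_pos_of_pos_on (diff_int hβ k0 k1 m1 m2)
      (fun u hu => mul_pos (hb2 (show u ∈ Ioo s b from ⟨by linarith [hu.1], by linarith [hu.2]⟩))
        (zeta_pos hβ (by linarith [hu.1, hs.1]) (by linarith [hu.2]))) (show a < d by linarith)
    linarith
  apply hne
  refine eq_of_distF h0 h1 fun s hs => le_antisymm (key h0 h1 hA s hs) (key h1 h0 ?_ s hs)
  intro c hc hc1
  have : Af β μ1 μ0 c = - Af β μ0 μ1 c := by
    unfold Af
    rw [← intervalIntegral.integral_neg]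
    congr 1; ext u; ring
  rw [this, hA c hc hc1, neg_zero]

lemma Q_bound {β : ℕ → ℝ} (hβ : ValidBeta β) {μ0 μ1 : Measure ℝ} (h0 : MemM μ0) (h1 : MemM μ1)
    {N : ℕ} (hN : 0 < N) :
    ∫ s in (0:ℝ)..1, Af β μ0 μ1 s ^ 2 * zetaFn β s ≤
      2 * (∑ j ∈ Finset.range N, Ar (mD μ0 N) (mD μ1 N) (rD β N) j ^ 2 * rD β N j ^ 2)
        + 2 * (5 * Zb β / N) ^ 2 * Zb β := by
  have hN' : (0:ℝ) < N := by exact_mod_cast hN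
  have hZ := Zb_pos β
  have hfi : ∀ {a b : ℝ}, a ∈ Icc (0:ℝ) 1 → b ∈ Icc (0:ℝ) 1 →
      IntervalIntegrable (fun s => Af β μ0 μ1 s ^ 2 * zetaFn β s) volume a b := fun ha hb =>
    ((((Af_cont hβ h0 h1).pow 2).mul (zeta_cont hβ)).mono (uIcc_subset_Icc ha hb)).intervalIntegrable
  rw [unit_split _ hN (hfi (by simp) (by simp)), ← Finset.sum_range_reflect]
  have hj : ∀ j ∈ Finset.range N,
      ∫ s in (((N - 1 - j : ℕ):ℝ) / N)..((((N - 1 - j : ℕ):ℝ) + 1) / N), Af β μ0 μ1 s ^ 2 * zetaFn β s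
      ≤ 2 * (Ar (mD μ0 N) (mD μ1 N) (rD β N) j ^ 2 * rD β N j ^ 2)
        + 2 * (5 * Zb β / N) ^ 2 * (Zb β / N) := by
    intro j hj
    have hj := Finset.mem_range.1 hj
    have hsq := rD_sq hβ hN j
    have hsqle := rD_sq_le hβ hN j
    rw [Af_nu hβ h0 h1 hN j hj.le]
    set k := N - 1 - j with hk
    have hkN : k < N := by omega
    have e1 : N - j = k + 1 := by omega
    rw [e1]
    have g1 := grid_mem hN hkN.le
    have g2 := grid_mem hN (Nat.succ_le_of_lt hkN)
    have hle : (k:ℝ) / N ≤ ((k + 1 : ℕ):ℝ) / N := by gcongr; simp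
    set a := Af β (nuD μ0 N) (nuD μ1 N) (((k + 1 : ℕ):ℝ) / N) with ha
    have e3 : ((k:ℝ) + 1) / N = ((k + 1 : ℕ):ℝ) / N := by push_cast; rfl
    rw [e3]
    have hd := Af_dist hβ h0 h1 (nuD_memM h0 hN) (nuD_memM h1 hN) g2
    rw [← ha] at hd
    have hd2 : Zb β * (dM μ0 (nuD μ0 N) + dM μ1 (nuD μ1 N)) ≤ 4 * Zb β / N := by
      calc _ ≤ Zb β * (2 / N + 2 / N) :=
            mul_le_mul_of_nonneg_left (add_le_add (dM_nuD h0 hN) (dM_nuD h1 hN)) (by linarith)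
        _ = _ := by ring
    calc _ ≤ ∫ s in ((k:ℝ) / N)..(((k + 1 : ℕ):ℝ) / N), (2 * a ^ 2 + 2 * (5 * Zb β / N) ^ 2) * zetaFn β s := by
          refine intervalIntegral.integral_mono_on hle (hfi g1 g2)
            ((zeta_intervalIntegrable hβ g1 g2).const_mul _) fun s hs => ?_
          have hs1 : s ∈ Icc (0:ℝ) 1 := ⟨g1.1.trans hs.1, hs.2.trans g2.2⟩
          refine mul_le_mul_of_nonneg_right ?_ (zeta_nonneg β hs1.1)
          have hl := Af_lip hβ h0 h1 hs1 g2
          have hl2 : Zb β * |((k + 1 : ℕ):ℝ) / N - s| ≤ Zb β / N := by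
            rw [div_eq_mul_one_div (Zb β)]
            refine mul_le_mul_of_nonneg_left ?_ (by linarith)
            rw [abs_of_nonneg (by linarith [hs.2])]
            have := hs.1
            have e4 : ((k + 1 : ℕ):ℝ) / N = (k:ℝ) / N + 1 / N := by push_cast; ring
            linarith
          have ht : |Af β μ0 μ1 s - a| ≤ 5 * Zb β / N := by
            calc _ ≤ |Af β μ0 μ1 s - Af β μ0 μ1 (((k + 1 : ℕ):ℝ) / N)| +
                  |Af β μ0 μ1 (((k + 1 : ℕ):ℝ) / N) - a| := abs_sub_le _ _ _
              _ ≤ Zb β / N + 4 * Zb β / N := add_le_add (hl.trans hl2) (hd.trans hd2)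
              _ = _ := by ring
          have hsq2 : (Af β μ0 μ1 s - a) ^ 2 ≤ (5 * Zb β / N) ^ 2 := by
            rw [← sq_abs]; exact pow_le_pow_left₀ (abs_nonneg _) ht 2
          nlinarith [sq_nonneg (Af β μ0 μ1 s - 2 * a)]
      _ = (2 * a ^ 2 + 2 * (5 * Zb β / N) ^ 2) * rD β N j ^ 2 := by
          rw [intervalIntegral.integral_const_mul, ← xiD_sub hβ g1 g2, hsq]
      _ ≤ _ := by
          have := mul_le_mul_of_nonneg_left hsqle (show 0 ≤ 2 * (5 * Zb β / N) ^ 2 by positivity)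
          nlinarith
  refine (Finset.sum_le_sum hj).trans (le_of_eq ?_)
  rw [Finset.sum_add_distrib, ← Finset.mul_sum]
  simp only [Finset.sum_const, Finset.card_range, nsmul_eq_mul]
  congr 1
  field_simp

lemma Phi_strict {β : ℕ → ℝ} (hβ : ValidBeta β) {Φ : Measure ℝ → ℝ → ℝ → ℝ}
    (hΦ : IsParisiFamily β Φ) (h : ℝ) {μ0 μ1 : Measure ℝ} (h0 : MemM μ0) (h1 : MemM μ1)
    (hne : μ0 ≠ μ1) :
    Φ (mid μ0 μ1) 0 h < (1/2) * Φ μ0 0 h + (1/2) * Φ μ1 0 h := by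
  have hZ := Zb_pos β
  have hQ := QI_pos hβ h0 h1 hne
  set QI := ∫ s in (0:ℝ)..1, Af β μ0 μ1 s ^ 2 * zetaFn β s with hQI
  obtain ⟨cs, hcs, H⟩ := gap_rec (Zb β) (QI / 4) h (by linarith) (by linarith)
  have hC := C5_nonneg (T := Zb β) (by linarith)
  have tN : Tendsto (fun N : ℕ => Zb β / (N:ℝ)) atTop (nhds 0) :=
    tendsto_const_div_atTop_nhds_zero_nat _
  have t5 : Tendsto (fun N : ℕ => 2 * (5 * (Zb β / (N:ℝ))) ^ 2 * Zb β) atTop (nhds 0) := by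
    have := (((tN.const_mul 5).pow 2).const_mul 2).mul_const (Zb β)
    simpa using this
  have tL : Tendsto (fun N : ℕ => cs - C5 (Zb β) * (Zb β * Real.sqrt (Zb β / (N:ℝ)))) atTop (nhds cs) := by
    have a : Tendsto (fun N : ℕ => Real.sqrt (Zb β / (N:ℝ))) atTop (nhds 0) := by
      have := (Real.continuous_sqrt.tendsto 0).comp tN
      rw [Real.sqrt_zero] at this
      exact this
    have := tendsto_const_nhds (x := cs) |>.sub ((a.const_mul (Zb β)).const_mul (C5 (Zb β)))
    rw [mul_zero, mul_zero, sub_zero] at this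
    exact this
  have tR := (((Phi_lim hΦ h0 h).const_mul (1/2)).add ((Phi_lim hΦ h1 h).const_mul (1/2))).sub
    (Phi_lim hΦ (mid_memM h0 h1) h)
  have hle := le_of_tendsto_of_tendsto tL tR ?_
  · linarith
  filter_upwards [tN.eventually (gt_mem_nhds one_pos), t5.eventually (gt_mem_nhds (show 0 < QI / 2 by linarith)),
    eventually_gt_atTop 0] with N hN1 hN2 hN
  have hN' : (0:ℝ) < N := by exact_mod_cast hN
  have hrp := rD_pos hβ hN
  have hr2 := rD_sq_le hβ hN
  have hrs : ∀ n, rD β N n ≤ Real.sqrt (Zb β / N) := fun n => Real.le_sqrt_of_sq_le (hr2 n)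
  have hr1 : ∀ n, rD β N n ≤ 1 := fun n => by
    have := hr2 n
    have := hrp n
    nlinarith
  have hsr : sr (rD β N) N ≤ Zb β := by
    unfold sr
    calc _ ≤ ∑ j ∈ Finset.range N, Zb β / N := Finset.sum_le_sum fun j _ => hr2 j
      _ = _ := by simp; field_simp
  have hr3 : ∑ j ∈ Finset.range N, rD β N j ^ 3 ≤ Zb β * Real.sqrt (Zb β / N) := by
    calc _ ≤ ∑ j ∈ Finset.range N, (Zb β / N) * Real.sqrt (Zb β / N) := by
          refine Finset.sum_le_sum fun j _ => ?_
          rw [pow_succ]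
          exact mul_le_mul (hr2 j) (hrs j) (hrp j).le (by positivity)
      _ = _ := by
          rw [Finset.sum_const, Finset.card_range, nsmul_eq_mul]
          generalize Real.sqrt (Zb β / N) = y
          field_simp
  have hq := Q_bound hβ h0 h1 hN
  rw [← hQI] at hq
  have e5 : 5 * Zb β / (N:ℝ) = 5 * (Zb β / N) := by ring
  rw [e5] at hq
  have := H (mD μ0 N) (mD μ1 N) (mD (mid μ0 μ1) N) (rD β N) (mD_pos h0 hN) (mD_le h0 hN)
    (mD_pos h1 hN) (mD_le h1 hN) (mid_mD h0 h1 N) hrp hr1 N hsr (by linarith)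
  have h6 := mul_le_mul_of_nonneg_left hr3 hC
  linarith

lemma lin_int {β : ℕ → ℝ} (hβ : ValidBeta β) {μ : Measure ℝ} (h0 : MemM μ) :
    IntervalIntegrable (fun s => s * zetaFn β s * distF μ s) volume 0 1 :=
  (distF_int h0 0 1).continuousOn_mul (by
    rw [uIcc_of_le zero_le_one]; exact continuousOn_id.mul (zeta_cont hβ))

lemma parisi_strict {β : ℕ → ℝ} (hβ : ValidBeta β) {Φ : Measure ℝ → ℝ → ℝ → ℝ}
    (hΦ : IsParisiFamily β Φ) (h : ℝ) {μ0 μ1 : Measure ℝ} (h0 : MemM μ0) (h1 : MemM μ1)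
    (hne : μ0 ≠ μ1) :
    parisiVal β Φ h (mid μ0 μ1) < (1/2) * parisiVal β Φ h μ0 + (1/2) * parisiVal β Φ h μ1 := by
  have hs := Phi_strict hβ hΦ h h0 h1 hne
  have e : ∫ s in (0:ℝ)..1, s * zetaFn β s * distF (mid μ0 μ1) s =
      (1/2) * (∫ s in (0:ℝ)..1, s * zetaFn β s * distF μ0 s) +
      (1/2) * (∫ s in (0:ℝ)..1, s * zetaFn β s * distF μ1 s) := by
    rw [← intervalIntegral.integral_const_mul, ← intervalIntegral.integral_const_mul,
      ← intervalIntegral.integral_add ((lin_int hβ h0).const_mul _) ((lin_int hβ h1).const_mul _)]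
    congr 1; ext s; rw [mid_distF h0 h1]; ring
  unfold parisiVal
  rw [e]
  linarith

/-! ### Existence -/

lemma meas_Iic {ρ : Measure ℝ} (hρ : MemM ρ) (s : ℝ) : distF ρ s = (ρ (Iic s)).toReal := by
  unfold distF
  congr 1
  refine le_antisymm (measure_mono Icc_subset_Iic_self) ?_
  calc ρ (Iic s) ≤ ρ (Icc 0 s ∪ (Icc 0 1)ᶜ) := by
        apply measure_mono; intro x hx
        by_cases h0 : 0 ≤ x
        · exact Or.inl ⟨h0, hx⟩
        · exact Or.inr (fun h => h0 h.1)
    _ ≤ ρ (Icc 0 s) + ρ (Icc 0 1)ᶜ := measure_union_le _ _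
    _ = _ := by rw [hρ.2, add_zero]

def KM : Set (ProbabilityMeasure ℝ) := {μ | MemM (μ : Measure ℝ)}

lemma KM_compact : IsCompact KM := by
  have h := isCompact_setOfPred_probabilityMeasure_mass_eq_compl_isCompact_le (E := ℝ)
    (u := fun _ => 0) (K := fun _ => Icc (0:ℝ) 1) tendsto_const_nhds (fun _ => isCompact_Icc)
    (Or.inl inferInstance)
  convert h using 1
  ext μ
  simp only [KM, MemM, mem_ofPred_eq, forall_const, nonpos_iff_eq_zero]
  rw [ProbabilityMeasure.null_iff_toMeasure_null]
  exact ⟨fun h => h.2, fun h => ⟨inferInstance, h⟩⟩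

lemma distF_tendsto {μ : ProbabilityMeasure ℝ} (hμ : μ ∈ KM) {s : ℝ} (hs : (μ : Measure ℝ) {s} = 0) :
    Tendsto (fun ν : ProbabilityMeasure ℝ => distF (ν : Measure ℝ) s) (nhdsWithin μ KM)
      (nhds (distF (μ : Measure ℝ) s)) := by
  have t : Tendsto (fun ν : ProbabilityMeasure ℝ => ν) (nhdsWithin μ KM) (nhds μ) :=
    tendsto_id.mono_left nhdsWithin_le_nhds
  have h := ProbabilityMeasure.tendsto_measure_of_null_frontier_of_tendsto' t (E := Iic s)
    (by rw [frontier_Iic]; exact hs)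
  have h2 := (ENNReal.tendsto_toReal (measure_ne_top (μ : Measure ℝ) (Iic s))).comp h
  rw [meas_Iic hμ]
  refine h2.congr' ?_
  filter_upwards [self_mem_nhdsWithin] with ν hν
  rw [meas_Iic hν]; rfl

lemma ae_not_atom (μ : ProbabilityMeasure ℝ) : ∀ᵐ s : ℝ, (μ : Measure ℝ) {s} = 0 := by
  have h := Measure.countable_meas_pos_of_disjoint_iUnion (μ := (μ : Measure ℝ))
    (As := fun s : ℝ => ({s} : Set ℝ)) (fun _ => measurableSet_singleton _)
    (fun a b hab => by simpa [Function.onFun] using hab)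
  have h2 := h.ae_notMem volume
  filter_upwards [h2] with s hs
  simpa using hs

lemma dM_tendsto {μ : ProbabilityMeasure ℝ} (hμ : μ ∈ KM) :
    Tendsto (fun ν : ProbabilityMeasure ℝ => dM (μ : Measure ℝ) (ν : Measure ℝ)) (nhdsWithin μ KM)
      (nhds 0) := by
  have h := intervalIntegral.tendsto_integral_filter_of_dominated_convergence (μ := volume)
    (a := (0:ℝ)) (b := 1) (l := nhdsWithin μ KM) (f := fun _ => (0:ℝ))
    (F := fun (ν : ProbabilityMeasure ℝ) s => |distF (μ : Measure ℝ) s - distF (ν : Measure ℝ) s|)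
    (fun _ => 1) ?_ ?_ (by simp) ?_
  · simpa [dM] using h
  · filter_upwards [self_mem_nhdsWithin] with ν hν
    exact (intervalIntegrable_iff.1 (dist_int hμ hν 0 1)).aestronglyMeasurable
  · filter_upwards [self_mem_nhdsWithin] with ν hν
    refine ae_of_all _ fun s _ => ?_
    rw [Real.norm_eq_abs, abs_abs, abs_le]
    constructor <;> linarith [distF_nonneg (μ : Measure ℝ) s, distF_nonneg (ν : Measure ℝ) s,
      distF_le_one hμ s, distF_le_one hν s]
  · filter_upwards [ae_not_atom μ] with s hs _
    have := ((tendsto_const_nhds (x := distF (μ : Measure ℝ) s)).sub (distF_tendsto hμ hs)).abs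
    simpa using this

lemma parisi_cont {β : ℕ → ℝ} (hβ : ValidBeta β) {Φ : Measure ℝ → ℝ → ℝ → ℝ}
    (hΦ : IsParisiFamily β Φ) (h : ℝ) :
    ContinuousOn (fun μ : ProbabilityMeasure ℝ => parisiVal β Φ h (μ : Measure ℝ)) KM := by
  intro μ hμ
  have t1 : Tendsto (fun ν : ProbabilityMeasure ℝ => Φ (ν : Measure ℝ) 0 h) (nhdsWithin μ KM)
      (nhds (Φ (μ : Measure ℝ) 0 h)) := by
    rw [Metric.tendsto_nhds]
    intro ε hε
    obtain ⟨δ, hδ, H⟩ := hΦ.2 _ hμ ε hε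
    filter_upwards [self_mem_nhdsWithin, (dM_tendsto hμ).eventually (gt_mem_nhds hδ)] with ν hν hd
    rw [Real.dist_eq, abs_sub_comm]
    exact H _ hν hd 0 (by simp) h
  have t2 : Tendsto (fun ν : ProbabilityMeasure ℝ =>
      ∫ s in (0:ℝ)..1, s * zetaFn β s * distF (ν : Measure ℝ) s) (nhdsWithin μ KM)
      (nhds (∫ s in (0:ℝ)..1, s * zetaFn β s * distF (μ : Measure ℝ) s)) := by
    refine intervalIntegral.tendsto_integral_filter_of_dominated_convergence (fun _ => Zb β)
      ?_ ?_ (by simp) ?_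
    · filter_upwards [self_mem_nhdsWithin] with ν hν
      exact (intervalIntegrable_iff.1 (lin_int hβ hν)).aestronglyMeasurable
    · filter_upwards [self_mem_nhdsWithin] with ν hν
      refine ae_of_all _ fun s hs => ?_
      rw [uIoc_of_le zero_le_one] at hs
      have hz := zeta_nonneg β hs.1.le
      have hz2 := zeta_le hβ (show s ∈ Icc (0:ℝ) 1 from ⟨hs.1.le, hs.2⟩)
      have hd := distF_nonneg (ν : Measure ℝ) s
      have hd2 := distF_le_one hν s
      rw [Real.norm_of_nonneg (mul_nonneg (mul_nonneg hs.1.le hz) hd)]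
      calc s * zetaFn β s * distF (ν : Measure ℝ) s ≤ s * zetaFn β s * 1 :=
            mul_le_mul_of_nonneg_left hd2 (mul_nonneg hs.1.le hz)
        _ ≤ 1 * zetaFn β s := by
            rw [mul_one]; exact mul_le_mul_of_nonneg_right hs.2 hz
        _ ≤ _ := by rw [one_mul]; exact hz2
    · filter_upwards [ae_not_atom μ] with s hs _
      exact (distF_tendsto hμ hs).const_mul _
  exact (t1.const_add _).sub (t2.const_mul _)

/-- **Uniqueness of the Parisi measure.** For every `h ∈ ℝ`, the functional
`μ ↦ log 2 + Φ_μ(0,h) - (1/2)∫_0^1 s ξ''(s) μ([0,s]) ds` attains its minimum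
over `𝓜` at exactly one measure. -/
theorem stmt4 (β : ℕ → ℝ) (hβ : ValidBeta β)
    (Φ : Measure ℝ → ℝ → ℝ → ℝ) (hΦ : IsParisiFamily β Φ) (h : ℝ) :
    ∃ μ : Measure ℝ, MemM μ ∧
      (∀ ν : Measure ℝ, MemM ν → parisiVal β Φ h μ ≤ parisiVal β Φ h ν) ∧
      ∀ μ' : Measure ℝ, MemM μ' →
        (∀ ν : Measure ℝ, MemM ν → parisiVal β Φ h μ' ≤ parisiVal β Φ h ν) → μ' = μ := by
  have hne : KM.Nonempty := by
    refine ⟨⟨Measure.dirac 0, inferInstance⟩, (inferInstance : IsProbabilityMeasure (Measure.dirac (0:ℝ))), ?_⟩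
    simp
  obtain ⟨μ, hμ, hmin⟩ := KM_compact.exists_isMinOn hne (parisi_cont hβ hΦ h)
  refine ⟨μ, hμ, ?_, ?_⟩
  · intro ν hν
    exact hmin (show (⟨ν, hν.1⟩ : ProbabilityMeasure ℝ) ∈ KM from hν)
  · intro μ' hμ' hmin'
    by_contra hcon
    have hs := parisi_strict hβ hΦ h hμ' hμ hcon
    have a := hmin' _ (mid_memM hμ' hμ)
    have b := hmin' _ hμ
    have c : parisiVal β Φ h (μ : Measure ℝ) ≤ parisiVal β Φ h μ' :=
      hmin (show (⟨μ', hμ'.1⟩ : ProbabilityMeasure ℝ) ∈ KM from hμ')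
    linarith

end
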